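/- arXiv:1507.02640 — 2 statements merged into one kernel-verified Lean document; each statement's English description precedes it below -/
import Mathlib

section
/- Let q be a prime with q ≡ 1 (mod 4), let g ≥ 0, let D ∈ H_{2g+1}, and let k be a positive integer. Then L(1/2, χ_D)^k = Σ_{f ∈ M_{≤kg}} χ_D(f) d_k(f)/√|f| + Σ_{f ∈ M_{≤kg−1}} χ_D(f) d_k(f)/√|f|. -/
/- Setting: `F_q[x]` with `q` prime, `q ≡ 1 (mod 4)`.  `M_n` denotes the monic
polynomials of degree `n`, `M_{≤n}` those of degree at most `n`, `H_n` the monic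
squarefree polynomials of degree `n`. -/

open Polynomial

noncomputable section

attribute [local instance] Classical.propDecidable

abbrev Fqx (q : ℕ) := Polynomial (ZMod q)

/-- The (sub)type of monic irreducible polynomials over `F_q`. -/
abbrev MIrr (q : ℕ) := {P : Fqx q // P.Monic ∧ Irreducible P}

/-- The norm `|f| = q ^ deg f`, as a complex number. -/
def nm (q : ℕ) (f : Fqx q) : ℂ := (q : ℂ) ^ f.natDegree

/-- The monic polynomial `X ^ n + ∑ i < n, c i * X ^ i` of degree `n`; as `c` runs over
`Fin n → ZMod q`, this enumerates the monic polynomials of degree `n` exactly once. -/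
def monicOf (q n : ℕ) (c : Fin n → ZMod q) : Fqx q :=
  X ^ n + ∑ i : Fin n, C (c i) * X ^ (i : ℕ)

/-- The polynomial `∑ i < n, c i * X ^ i` of degree `< n`; as `c` runs over
`Fin n → ZMod q`, this enumerates the residues modulo a polynomial of degree `n`. -/
def polyOf (q n : ℕ) (c : Fin n → ZMod q) : Fqx q :=
  ∑ i : Fin n, C (c i) * X ^ (i : ℕ)

/-- The sum of `F` over the monic polynomials of degree `n` (empty if `n < 0`). -/
def sumMn (q : ℕ) [NeZero q] (n : ℤ) (F : Fqx q → ℂ) : ℂ :=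
  if 0 ≤ n then ∑ c : Fin n.toNat → ZMod q, F (monicOf q n.toNat c) else 0

/-- The sum of `F` over the monic polynomials of degree at most `n` (empty if `n < 0`). -/
def sumMle (q : ℕ) [NeZero q] (n : ℤ) (F : Fqx q → ℂ) : ℂ :=
  ∑ m ∈ Finset.range (n + 1).toNat, sumMn q m F

/-- The sum of `F` over `H_n`, the monic squarefree polynomials of degree `n`. -/
def sumH (q : ℕ) [NeZero q] (n : ℕ) (F : Fqx q → ℂ) : ℂ :=
  ∑ c : Fin n → ZMod q,
    if Squarefree (monicOf q n c) then F (monicOf q n c) else 0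

/-- The quadratic residue symbol `(f | P)` for `P` monic irreducible:  it is `0` if
`P ∣ f`, `1` if `P ∤ f` and `f` is a square modulo `P`, and `-1` otherwise. -/
def legSym (q : ℕ) (f P : Fqx q) : ℤ :=
  if P ∣ f then 0 else if ∃ g : Fqx q, P ∣ (g ^ 2 - f) then 1 else -1

/-- The Jacobi symbol `(f | u)`, extending the quadratic residue symbol
multiplicatively in the lower entry. -/
def jacSym (q : ℕ) [Fact q.Prime] (f u : Fqx q) : ℤ :=
  if u = 0 then (if IsUnit f then 1 else 0)
  else ((UniqueFactorizationMonoid.factors u).map fun P => legSym q f P).prod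

/-- The character `χ_D(f) = (D | f)`, as a complex number. -/
def chi (q : ℕ) [Fact q.Prime] (D f : Fqx q) : ℂ := jacSym q D f

/-- `d_k(f)`: the number of ways of writing `f` as an ordered product of `k` monic
polynomials. -/
def dk (q k : ℕ) (f : Fqx q) : ℕ :=
  Nat.card {t : Fin k → Fqx q // (∀ i, (t i).Monic) ∧ ∏ i, t i = f}

/-- The exponential `e(a/f) = exp(2πi a₁/q)`, where `a₁ ∈ F_q ≅ ℤ/q` is the coefficient
of `1/x` in the Laurent expansion of `a/f` at infinity, i.e. the coefficient of
`x^(deg f - 1)` in `a mod f`. -/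
def eQ (q : ℕ) (f a : Fqx q) : ℂ :=
  Complex.exp (2 * (Real.pi : ℂ) * Complex.I * (((a %ₘ f).coeff (f.natDegree - 1)).val : ℂ) / q)

/-- The generalized Gauss sum `G(V, χ_f) = ∑_{u mod f} χ_f(u) e(uV/f)`. -/
def gSum (q : ℕ) [Fact q.Prime] (V f : Fqx q) : ℂ :=
  ∑ c : Fin f.natDegree → ZMod q,
    chi q f (polyOf q f.natDegree c) * eQ q f (polyOf q f.natDegree c * V)

/-- `L(1/2, χ_D)`: since `L(s, χ_D) = ∑_{f ∈ M} χ_D(f) |f|^{-s}` is a polynomial of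
degree `deg D - 1` in `q^{-s}` (for `D` squarefree of odd degree), this is the finite
sum `∑_{n < deg D} (∑_{f ∈ M_n} χ_D(f)) q^{-n/2}`. -/
def Lhalf (q : ℕ) [Fact q.Prime] (D : Fqx q) : ℂ :=
  ∑ n ∈ Finset.range D.natDegree,
    sumMn q n (fun f => chi q D f) / (Real.sqrt ((q : ℝ) ^ n) : ℂ)

/-- The L-series `L(w, χ_V) = ∑_{f ∈ M} χ_V(f) w^(deg f)`. -/
def Lser (q : ℕ) [Fact q.Prime] (V : Fqx q) (w : ℂ) : ℂ :=
  ∑' f : {f : Fqx q // f.Monic}, chi q V f.1 * w ^ f.1.natDegree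

/-- The Euler phi function: the number of units in `F_q[x]/(f)`. -/
def polyPhi (q : ℕ) [Fact q.Prime] (f : Fqx q) : ℕ :=
  Nat.card ((Fqx q ⧸ Ideal.span {f}))ˣ

/-- `Z(u) = (1 - qu)⁻¹`. -/
def Zf (q : ℕ) (u : ℂ) : ℂ := (1 - q * u)⁻¹

/-- The Euler product `B(u) = ∏_P (1 + u^d(u^d - 3)/((|P|+1)(1+u^d)))`, `d = d(P)`. -/
def Bfun (q : ℕ) (u : ℂ) : ℂ :=
  ∏' P : MIrr q, (1 + u ^ P.1.natDegree * (u ^ P.1.natDegree - 3) /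
    ((nm q P.1 + 1) * (1 + u ^ P.1.natDegree)))

/-- The Euler product `B_3(u)` from the third-moment main term. -/
def B3fun (q : ℕ) (u : ℂ) : ℂ :=
  ∏' P : MIrr q,
    (1 - (6 * u ^ P.1.natDegree - (15 - 6 * nm q P.1) * u ^ (2 * P.1.natDegree)
      + (20 - 8 * nm q P.1) * u ^ (3 * P.1.natDegree)
      - (15 - 3 * nm q P.1) * u ^ (4 * P.1.natDegree)
      + 6 * u ^ (5 * P.1.natDegree) - u ^ (6 * P.1.natDegree)) / (nm q P.1 + 1))

/-- `∑_{C ∈ M_{≤ g-1}, C | f^∞} |C|⁻²`, where `C | f^∞` means that every monic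
irreducible factor of `C` divides `f`. -/
def sumCdiv (q : ℕ) [NeZero q] (g : ℕ) (f : Fqx q) : ℂ :=
  sumMle q ((g : ℤ) - 1) fun Cp =>
    if ∀ P : Fqx q, P.Monic → Irreducible P → P ∣ Cp → P ∣ f
    then ((q : ℂ) ^ (2 * Cp.natDegree))⁻¹ else 0

/-- The main term `q^(2g+1) (1 - 1/q) ∑_{f ∈ M_{≤N}, f = □} d_k(f) φ(f) |f|^{-3/2}
∑_{C ∈ M_{≤g-1}, C|f^∞} |C|⁻²`. -/
def Mterm (q : ℕ) [Fact q.Prime] (k : ℕ) (N : ℤ) (g : ℕ) : ℂ :=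
  (q : ℂ) ^ (2 * g + 1) * (1 - 1 / q) * sumMle q N fun f =>
    if IsSquare f then
      (dk q k f : ℂ) * polyPhi q f / (Real.sqrt ((q : ℝ) ^ (3 * f.natDegree)) : ℂ)
        * sumCdiv q g f
    else 0

/-- The secondary main term `S_{kg}(V = □)` (with `N = kg` or `kg - 1`). -/
def Ssq (q : ℕ) [Fact q.Prime] (k : ℕ) (N : ℤ) (g : ℕ) : ℂ :=
  (q : ℂ) ^ (2 * g + 1) * sumMle q N fun f =>
    if Even f.natDegree then
      (dk q k f : ℂ) / (Real.sqrt ((q : ℝ) ^ (3 * f.natDegree)) : ℂ) *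
        sumMle q ((g : ℤ) - 1) (fun Cp =>
          if ∀ P : Fqx q, P.Monic → Irreducible P → P ∣ Cp → P ∣ f then
            ((q : ℂ) ^ (2 * Cp.natDegree))⁻¹ *
              ((q - 1) * sumMle q ((f.natDegree : ℤ) / 2 - g - 2 + Cp.natDegree)
                  (fun l => gSum q (l ^ 2) f)
                - sumMn q ((f.natDegree : ℤ) / 2 - g - 1 + Cp.natDegree)
                    (fun l => gSum q (l ^ 2) f)
                - (q - 1) / q * sumMle q ((f.natDegree : ℤ) / 2 - g - 1 + Cp.natDegree)
                    (fun l => gSum q (l ^ 2) f)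
                + (1 / q) * sumMn q ((f.natDegree : ℤ) / 2 - g + Cp.natDegree)
                    (fun l => gSum q (l ^ 2) f))
          else 0)
    else 0

/-- The odd-degree part `S_{kg,o}` (with `N = kg` or `kg - 1`). -/
def Sodd (q : ℕ) [Fact q.Prime] (k : ℕ) (N : ℤ) (g : ℕ) : ℂ :=
  (q : ℂ) ^ (2 * g + 1) * (Real.sqrt q : ℂ) * sumMle q N fun f =>
    if Odd f.natDegree then
      (dk q k f : ℂ) / (Real.sqrt ((q : ℝ) ^ (3 * f.natDegree)) : ℂ) *
        sumMle q ((g : ℤ) - 1) (fun Cp =>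
          if ∀ P : Fqx q, P.Monic → Irreducible P → P ∣ Cp → P ∣ f then
            ((q : ℂ) ^ (2 * Cp.natDegree))⁻¹ *
              (sumMn q ((f.natDegree : ℤ) - 2 * g - 2 + 2 * Cp.natDegree)
                  (fun V => gSum q V f)
                - (1 / q) * sumMn q ((f.natDegree : ℤ) - 2 * g + 2 * Cp.natDegree)
                    (fun V => gSum q V f))
          else 0)
    else 0

/-- The even-degree, non-square-`V` part `S_{kg,e}(V ≠ □)` (with `N = kg` or `kg-1`). -/
def SevNS (q : ℕ) [Fact q.Prime] (k : ℕ) (N : ℤ) (g : ℕ) : ℂ :=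
  (q : ℂ) ^ (2 * g + 1) * sumMle q N fun f =>
    if Even f.natDegree then
      (dk q k f : ℂ) / (Real.sqrt ((q : ℝ) ^ (3 * f.natDegree)) : ℂ) *
        sumMle q ((g : ℤ) - 1) (fun Cp =>
          if ∀ P : Fqx q, P.Monic → Irreducible P → P ∣ Cp → P ∣ f then
            ((q : ℂ) ^ (2 * Cp.natDegree))⁻¹ *
              ((q - 1) * sumMle q ((f.natDegree : ℤ) - 2 * g - 3 + 2 * Cp.natDegree)
                  (fun V => if IsSquare V then 0 else gSum q V f)
                - sumMn q ((f.natDegree : ℤ) - 2 * g - 2 + 2 * Cp.natDegree)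
                    (fun V => if IsSquare V then 0 else gSum q V f)
                - (q - 1) / q * sumMle q ((f.natDegree : ℤ) - 2 * g - 1 + 2 * Cp.natDegree)
                    (fun V => if IsSquare V then 0 else gSum q V f)
                + (1 / q) * sumMn q ((f.natDegree : ℤ) - 2 * g + 2 * Cp.natDegree)
                    (fun V => if IsSquare V then 0 else gSum q V f))
          else 0)
    else 0

/-- `∏_{P | f} (1 - |P|⁻² z^{-d(P)})`, a finite product written as a `tprod`. -/
def prodC (q : ℕ) (z : ℂ) (f : Fqx q) : ℂ :=
  ∏' P : {P : Fqx q // P.Monic ∧ Irreducible P ∧ P ∣ f},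
    (1 - 1 / (nm q P.1 ^ 2 * z ^ P.1.natDegree))

/-- `M(V; z, w) = ∑_{f ∈ M} d₂(f) G(V,χ_f) / (√|f| ∏_{P|f}(1 - |P|⁻²z^{-d(P)})) w^(deg f)`. -/
def Mser (q : ℕ) [Fact q.Prime] (V : Fqx q) (z w : ℂ) : ℂ :=
  ∑' f : {f : Fqx q // f.Monic},
    (dk q 2 f.1 : ℂ) * gSum q V f.1 /
      ((Real.sqrt ((q : ℝ) ^ f.1.natDegree) : ℂ) * prodC q z f.1) * w ^ f.1.natDegree

/-- The local factor `M_P(V; z, w)`. -/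
def MPf (q : ℕ) [Fact q.Prime] (V : Fqx q) (z w : ℂ) (P : Fqx q) : ℂ :=
  if P ∣ V then
    1 + (1 - 1 / (nm q P ^ 2 * z ^ P.natDegree))⁻¹ *
      ∑' b : ℕ, (dk q 2 (P ^ (b + 1)) : ℂ) * gSum q V (P ^ (b + 1)) /
        (Real.sqrt ((q : ℝ) ^ ((b + 1) * P.natDegree)) : ℂ) * w ^ ((b + 1) * P.natDegree)
  else
    1 + 2 * (jacSym q V P : ℂ) * w ^ P.natDegree / (nm q P ^ 2 * z ^ P.natDegree - 1)
      + w ^ (2 * P.natDegree)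
      - 4 * w ^ (2 * P.natDegree) / (1 - 1 / (nm q P ^ 2 * z ^ P.natDegree))
      + 2 * (jacSym q V P : ℂ) * w ^ (3 * P.natDegree) /
          (1 - 1 / (nm q P ^ 2 * z ^ P.natDegree))

/-- The local factor `R_P(l²; z, w)`. -/
def RPf (q : ℕ) [Fact q.Prime] (l : Fqx q) (z w : ℂ) (P : Fqx q) : ℂ :=
  if P ∣ l then
    (1 - w ^ P.natDegree) ^ 2 *
      (1 + (1 - 1 / (nm q P ^ 2 * z ^ P.natDegree))⁻¹ *
        ∑' b : ℕ, (dk q 2 (P ^ (b + 1)) : ℂ) * gSum q (l ^ 2) (P ^ (b + 1)) /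
          (Real.sqrt ((q : ℝ) ^ ((b + 1) * P.natDegree)) : ℂ) * w ^ ((b + 1) * P.natDegree))
  else
    1 + 2 * w ^ P.natDegree / (nm q P ^ 2 * z ^ P.natDegree - 1)
      + w ^ (2 * P.natDegree)
      - 4 * w ^ (2 * P.natDegree) / (1 - 1 / (nm q P ^ 2 * z ^ P.natDegree))
      + 2 * w ^ (3 * P.natDegree) / (1 - 1 / (nm q P ^ 2 * z ^ P.natDegree))

/-- `R(z, w) = ∑_{l ∈ M} z^(deg l) ∏_P R_P(l²; z, w)`. -/
def Rser (q : ℕ) [Fact q.Prime] (z w : ℂ) : ℂ :=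
  ∑' l : {l : Fqx q // l.Monic}, z ^ l.1.natDegree * ∏' P : MIrr q, RPf q l.1 z w P.1

/-- The local factor `F_P(z, w)`. -/
def FPf (q : ℕ) (z w : ℂ) (P : Fqx q) : ℂ :=
  (1 - w ^ P.natDegree) ^ 2 *
    (1 - (1 - 2 * nm q P ^ 2 * (w * z) ^ P.natDegree - 2 * nm q P * (w ^ 2 * z) ^ P.natDegree
        + 2 * nm q P ^ 2 * (w * z ^ 2) ^ P.natDegree
        + (-2 * nm q P ^ 3 + 3 * nm q P ^ 2) * (w ^ 2 * z ^ 2) ^ P.natDegree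
        + nm q P ^ 2 * (w ^ 4 * z ^ 2) ^ P.natDegree
        - nm q P ^ 3 * (w ^ 4 * z ^ 3) ^ P.natDegree) /
      (nm q P ^ 2 * z ^ P.natDegree * (1 - nm q P * w ^ (2 * P.natDegree) * z ^ P.natDegree)))

/-- `F(z, w) = ∏_P F_P(z, w)`. -/
def Ffull (q : ℕ) (z w : ℂ) : ℂ := ∏' P : MIrr q, FPf q z w P.1

/-- `F(z) = F(z, 1/q)`. -/
def Fone (q : ℕ) (z : ℂ) : ℂ := Ffull q z (1 / q)

/-- `α(z) = (1/q) ∂_w F(z, w)|_{w = 1/q} / F(z, 1/q)`. -/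
def alphaF (q : ℕ) (z : ℂ) : ℂ := (1 / (q : ℂ)) * deriv (Ffull q z) (1 / q) / Fone q z

/-- The explicit formula for `F(z)`:
`∏_P (1 - 1/|P|)² (1 + 2/|P| + 1/|P|³ - (z^d + z^{-d})/|P|²)`. -/
def Fexp (q : ℕ) (z : ℂ) : ℂ :=
  ∏' P : MIrr q,
    ((1 - 1 / nm q P.1) ^ 2 *
      (1 + 2 / nm q P.1 + 1 / nm q P.1 ^ 3 -
        (z ^ P.1.natDegree + z⁻¹ ^ P.1.natDegree) / nm q P.1 ^ 2))

/-- The explicit formula for `α(z)`. -/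
def alphaExp (q : ℕ) (z : ℂ) : ℂ :=
  ∑' P : MIrr q,
    2 * (P.1.natDegree : ℂ) *
      (nm q P.1 ^ 2 + z ^ P.1.natDegree * (-3 * nm q P.1 ^ 3 - 3 * nm q P.1 + nm q P.1 ^ 2)
        + z ^ (2 * P.1.natDegree) * (nm q P.1 ^ 4 - nm q P.1 ^ 3 + 4 * nm q P.1 ^ 2 - nm q P.1 + 2)
        + z ^ (3 * P.1.natDegree) * (nm q P.1 ^ 2 - 2 * nm q P.1)) /
      ((nm q P.1 - 1) * (z ^ P.1.natDegree - nm q P.1) *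
        (nm q P.1 - z ^ P.1.natDegree - 2 * nm q P.1 ^ 2 * z ^ P.1.natDegree
          - nm q P.1 ^ 3 * z ^ P.1.natDegree + nm q P.1 * z ^ (2 * P.1.natDegree)))

/-- `A(V; z, w) = ∑_{f ∈ M} w^(deg f) d₃(f) G(V,χ_f)/(√|f| ∏_{P|f}(1 - |P|⁻²z^{-d(P)}))`. -/
def Aser (q : ℕ) [Fact q.Prime] (V : Fqx q) (z w : ℂ) : ℂ :=
  ∑' f : {f : Fqx q // f.Monic},
    w ^ f.1.natDegree * (dk q 3 f.1 : ℂ) * gSum q V f.1 /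
      ((Real.sqrt ((q : ℝ) ^ f.1.natDegree) : ℂ) * prodC q z f.1)

/-- The local factor `H_P(V; z, w)` of `A(V; z, w)`. -/
def HP3f (q : ℕ) [Fact q.Prime] (V : Fqx q) (z w : ℂ) (P : Fqx q) : ℂ :=
  if P ∣ V then
    1 + (1 - 1 / (nm q P ^ 2 * z ^ P.natDegree))⁻¹ *
      ∑' i : ℕ, w ^ ((i + 1) * P.natDegree) * (dk q 3 (P ^ (i + 1)) : ℂ) *
        gSum q V (P ^ (i + 1)) / (Real.sqrt ((q : ℝ) ^ ((i + 1) * P.natDegree)) : ℂ)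
  else
    1 + 3 * (jacSym q V P : ℂ) * w ^ P.natDegree / (nm q P ^ 2 * z ^ P.natDegree - 1)
      + 3 * w ^ (2 * P.natDegree)
      - 9 * w ^ (2 * P.natDegree) / (1 - 1 / (nm q P ^ 2 * z ^ P.natDegree))
      - (jacSym q V P : ℂ) * w ^ (3 * P.natDegree)
      + 9 * (jacSym q V P : ℂ) * w ^ (3 * P.natDegree) /
          (1 - 1 / (nm q P ^ 2 * z ^ P.natDegree))
      - 3 * w ^ (4 * P.natDegree) / (1 - 1 / (nm q P ^ 2 * z ^ P.natDegree))

/-- The local factor `A_P(l²; z, w)`. -/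
def APf (q : ℕ) [Fact q.Prime] (l : Fqx q) (z w : ℂ) (P : Fqx q) : ℂ :=
  if P ∣ l then
    (1 - w ^ P.natDegree) ^ 3 *
      (1 + ∑' i : ℕ, w ^ ((i + 1) * P.natDegree) * (dk q 3 (P ^ (i + 1)) : ℂ) *
        gSum q (l ^ 2) (P ^ (i + 1)) /
          ((Real.sqrt ((q : ℝ) ^ ((i + 1) * P.natDegree)) : ℂ) *
            (1 - 1 / (nm q P ^ 2 * z ^ P.natDegree))))
  else
    1 + 3 * w ^ P.natDegree / (nm q P ^ 2 * z ^ P.natDegree - 1)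
      + 3 * w ^ (2 * P.natDegree)
      - 9 * w ^ (2 * P.natDegree) / (1 - 1 / (nm q P ^ 2 * z ^ P.natDegree))
      - w ^ (3 * P.natDegree)
      + 9 * w ^ (3 * P.natDegree) / (1 - 1 / (nm q P ^ 2 * z ^ P.natDegree))
      - 3 * w ^ (4 * P.natDegree) / (1 - 1 / (nm q P ^ 2 * z ^ P.natDegree))

/-- `C(z, w) = ∑_{l ∈ M} z^(deg l) ∏_P A_P(l²; z, w)`. -/
def Cser (q : ℕ) [Fact q.Prime] (z w : ℂ) : ℂ :=
  ∑' l : {l : Fqx q // l.Monic}, z ^ l.1.natDegree * ∏' P : MIrr q, APf q l.1 z w P.1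

/-- The local factor `H_P(z, w)`. -/
def HPf (q : ℕ) (z w : ℂ) (P : Fqx q) : ℂ :=
  (1 - w ^ P.natDegree) ^ 3 * (1 - nm q P * (w ^ 2 * z) ^ P.natDegree) ^ 3 *
    (1 + (w * z) ^ P.natDegree) ^ 3 *
    (1 + 3 * w ^ P.natDegree + 3 * nm q P * (z * w ^ 2) ^ P.natDegree
      + 3 * w ^ (2 * P.natDegree) / nm q P - 3 * (z * w) ^ P.natDegree
      - 1 / (nm q P ^ 2 * z ^ P.natDegree) - 6 * (z * w ^ 2) ^ P.natDegree
      + nm q P * (z * w ^ 3) ^ P.natDegree - 3 * (z * w ^ 4) ^ P.natDegree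
      - nm q P * (z ^ 2 * w ^ 3) ^ P.natDegree + 3 * nm q P * (z ^ 2 * w ^ 4) ^ P.natDegree
      + nm q P * (z ^ 2 * w ^ 6) ^ P.natDegree - nm q P ^ 2 * (z ^ 3 * w ^ 6) ^ P.natDegree)

/-- `H(z, w) = ∏_P H_P(z, w)`. -/
def Hfull (q : ℕ) (z w : ℂ) : ℂ := ∏' P : MIrr q, HPf q z w P.1

end

theorem resultant_eq_of_natDegree_le {R : Type*} [CommRing R] {D f : R[X]} (hD : D.Monic)
    {n : ℕ} (hn : f.natDegree ≤ n) :
    resultant D f D.natDegree n = resultant D f := by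
  obtain ⟨k, rfl⟩ := Nat.exists_eq_add_of_le hn
  rw [resultant_add_right_deg _ _ _ _ _ le_rfl, coeff_natDegree, hD.leadingCoeff, one_pow, one_mul]

theorem degree_C_mul_X_pow_add_mul_X_pow_lt {F : Type*} [Field F] {N n m : ℕ}
    (hN : n + m + 1 = N) (c : F) {b : F[X]}
    (hb : b.degree < m) : ((C c * X ^ m + b) * X ^ n).degree < (N : WithBot ℕ) := by
  have hy : (C c * X ^ m + b).natDegree ≤ m :=
    natDegree_add_le_of_degree_le (natDegree_C_mul_X_pow_le c m) (natDegree_le_of_degree_le hb.le)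
  refine degree_le_natDegree.trans_lt ?_
  have := natDegree_mul_le_of_le hy (natDegree_X_pow_le n (R := F))
  exact_mod_cast (by omega)

section ResidueChar

variable {F : Type*} [Field F] (e : AddChar F ℂ)

/-- The additive character `f ↦ e (f / D)`, given by the residue of `f / D` at infinity. -/
noncomputable def residueChar (D f : F[X]) : ℂ := e ((f %ₘ D).coeff (D.natDegree - 1))

theorem residueChar_zero (D : F[X]) : residueChar e D 0 = 1 := by
  simp [residueChar]

theorem residueChar_add (D f g : F[X]) :
    residueChar e D (f + g) = residueChar e D f * residueChar e D g := by
  rw [residueChar, add_modByMonic, coeff_add, AddChar.map_add_eq_mul, residueChar, residueChar]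

theorem residueChar_modByMonic {D : F[X]} (hD : D.Monic) (f : F[X]) :
    residueChar e D (f %ₘ D) = residueChar e D f := by
  rw [residueChar, (modByMonic_eq_self_iff hD).2 (degree_modByMonic_lt f hD), residueChar]

theorem residueChar_eq_of_dvd_sub {D f g : F[X]} (hD : D.Monic) (h : D ∣ f - g) :
    residueChar e D f = residueChar e D g := by
  rw [residueChar, residueChar, (modByMonic_eq_of_dvd_sub hD h)]

theorem residueChar_of_degree_lt {D f : F[X]} (hD : D.Monic) (hf : f.degree < D.natDegree) :
    residueChar e D f = e (f.coeff (D.natDegree - 1)) := by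
  rw [residueChar, (modByMonic_eq_self_iff hD).2 (by rwa [degree_eq_natDegree hD.ne_zero])]

theorem residueChar_mul_left {A B : F[X]} (hA : A.Monic) (hB : B.Monic) (f : F[X]) :
    residueChar e (A * B) (f * B) = residueChar e A f := by
  have hmod : (f * B) %ₘ (A * B) = (f %ₘ A) * B := by
    rw [modByMonic_eq_of_dvd_sub (hA.mul hB) (p₂ := (f %ₘ A) * B),
      modByMonic_eq_self_iff (hA.mul hB)]
    · rw [degree_mul, degree_mul, degree_eq_natDegree hB.ne_zero]
      exact WithBot.add_lt_add_right (by simp) (degree_modByMonic_lt f hA)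
    · rw [← sub_mul, modByMonic_eq_sub_mul_div, sub_sub_cancel]
      exact mul_dvd_mul_right (dvd_mul_right _ _) _
  rw [residueChar, residueChar, hmod, hA.natDegree_mul hB]
  rcases Nat.eq_zero_or_pos A.natDegree with h | h
  · rw [hA.natDegree_eq_zero.1 h]
    simp
  · have hle : (f %ₘ A).natDegree ≤ A.natDegree - 1 := by
      have := natDegree_modByMonic_lt f hA (by rintro rfl; simp at h)
      omega
    rw [show A.natDegree + B.natDegree - 1 = A.natDegree - 1 + B.natDegree by omega,
      coeff_mul_add_eq_of_natDegree_le hle le_rfl, hB.coeff_natDegree, mul_one]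

theorem residueChar_sq_eq_one {D b : F[X]} (hD : D.Monic) {m : ℕ} (hb : b.degree < m)
    (hm : 2 * m ≤ D.natDegree) : residueChar e D (b * b) = 1 := by
  by_cases hb0 : b = 0
  · rw [hb0, mul_zero, residueChar_zero]
  rw [degree_eq_natDegree hb0, Nat.cast_lt] at hb
  have hbb : (b * b).natDegree = b.natDegree + b.natDegree := natDegree_mul hb0 hb0
  rw [residueChar_of_degree_lt e hD, coeff_eq_zero_of_natDegree_lt (by omega),
    AddChar.map_zero_eq_one]
  rw [degree_eq_natDegree (mul_ne_zero hb0 hb0)]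
  exact_mod_cast (by omega)

end ResidueChar

section FiniteFieldPolynomials

variable {F : Type*} [Field F] [Fintype F]

theorem finite_setOf_degree_lt (n : ℕ) : {f : F[X] | f.degree < n}.Finite := by
  have : Finite (degreeLT F n) := Finite.of_equiv _ (degreeLTEquiv F n).toEquiv.symm
  exact (Set.toFinite (degreeLT F n : Set F[X])).subset fun f hf => mem_degreeLT.2 hf

theorem finite_setOf_monic_natDegree_eq (n : ℕ) :
    {f : F[X] | f.Monic ∧ f.natDegree = n}.Finite := by
  refine (finite_setOf_degree_lt (n + 1)).subset fun f hf => ?_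
  rw [Set.mem_ofPred_eq, degree_lt_iff_coeff_zero]
  exact fun m hm => coeff_eq_zero_of_natDegree_lt (by have := hf.2; omega)

/-- The finset of polynomials of degree less than `n`. -/
noncomputable def polysDegreeLT (F : Type*) [Field F] [Fintype F] (n : ℕ) : Finset F[X] :=
  (finite_setOf_degree_lt n).toFinset

/-- The finset of monic polynomials of degree `n`. -/
noncomputable def monicsOfDegree (F : Type*) [Field F] [Fintype F] (n : ℕ) : Finset F[X] :=
  (finite_setOf_monic_natDegree_eq n).toFinset

@[simp] theorem mem_polysDegreeLT {n : ℕ} {f : F[X]} :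
    f ∈ polysDegreeLT F n ↔ f.degree < n := by
  simp [polysDegreeLT]

@[simp] theorem mem_monicsOfDegree {n : ℕ} {f : F[X]} :
    f ∈ monicsOfDegree F n ↔ f.Monic ∧ f.natDegree = n := by
  simp [monicsOfDegree]

theorem card_polysDegreeLT (n : ℕ) : (polysDegreeLT F n).card = Fintype.card F ^ n := by
  have h : Nat.card (degreeLT F n) = Fintype.card F ^ n := by
    rw [Nat.card_congr (degreeLTEquiv F n).toEquiv]
    simp
  rw [← h, ← Nat.card_eq_finsetCard]
  exact Nat.card_congr (Equiv.subtypeEquivRight fun f => by simp [mem_degreeLT])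

theorem polysDegreeLT_zero : polysDegreeLT F 0 = {0} := by
  ext f
  simp

theorem sum_monicsOfDegree {M : Type*} [AddCommMonoid M] (n : ℕ) (H : F[X] → M) :
    ∑ f ∈ monicsOfDegree F n, H f = ∑ b ∈ polysDegreeLT F n, H (X ^ n + b) := by
  refine (Finset.sum_nbij' (fun b => X ^ n + b) (fun f => f - X ^ n) ?_ ?_ ?_ ?_ ?_).symm
  · intro b hb
    have hb := mem_polysDegreeLT.1 hb
    refine mem_monicsOfDegree.2 ⟨monic_X_pow_add hb, natDegree_eq_of_degree_eq_some ?_⟩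
    rw [degree_add_eq_left_of_degree_lt (by rwa [degree_X_pow]), degree_X_pow]
  · intro f hf
    obtain ⟨hm, rfl⟩ := mem_monicsOfDegree.1 hf
    rw [mem_polysDegreeLT, ← degree_eq_natDegree hm.ne_zero]
    exact degree_sub_lt_left (by rw [degree_X_pow, degree_eq_natDegree hm.ne_zero]) hm.ne_zero
      (by rw [hm.leadingCoeff, leadingCoeff_X_pow])
  · intro b _; simp
  · intro f _; simp
  · intro b _; rfl

theorem sum_polysDegreeLT_succ {M : Type*} [AddCommMonoid M] (n : ℕ) (H : F[X] → M) :
    ∑ f ∈ polysDegreeLT F (n + 1), H f =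
      ∑ c : F, ∑ b ∈ polysDegreeLT F n, H (C c * X ^ n + b) := by
  rw [← Finset.sum_product']
  refine (Finset.sum_nbij' (fun p => C p.1 * X ^ n + p.2)
    (fun f => (f.coeff n, f - C (f.coeff n) * X ^ n)) ?_ ?_ ?_ ?_ ?_).symm
  · rintro ⟨c, b⟩ hb
    have hb := mem_polysDegreeLT.1 (Finset.mem_product.1 hb).2
    rw [mem_polysDegreeLT]
    refine (degree_add_le _ _).trans_lt (max_lt ?_ (hb.trans (by exact_mod_cast n.lt_succ_self)))
    exact (degree_C_mul_X_pow_le n c).trans_lt (by exact_mod_cast n.lt_succ_self)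
  · intro f hf
    rw [mem_polysDegreeLT, degree_lt_iff_coeff_zero] at hf
    refine Finset.mem_product.2 ⟨Finset.mem_univ _, ?_⟩
    rw [mem_polysDegreeLT, degree_lt_iff_coeff_zero]
    intro m hm
    rcases hm.eq_or_lt with rfl | hm
    · simp
    · simp [coeff_X_pow, hm.ne', hf m hm]
  · rintro ⟨c, b⟩ hb
    have hb := mem_polysDegreeLT.1 (Finset.mem_product.1 hb).2
    simp [coeff_eq_zero_of_degree_lt hb]
  · intro f _; simp
  · rintro ⟨c, b⟩ _; rfl

theorem sum_polysDegreeLT_C_mul {M : Type*} [AddCommMonoid M] (n : ℕ) {c : F} (hc : c ≠ 0)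
    (H : F[X] → M) :
    ∑ f ∈ polysDegreeLT F n, H (C c * f) = ∑ f ∈ polysDegreeLT F n, H f := by
  refine Finset.sum_nbij' (fun f => C c * f) (fun f => C c⁻¹ * f) ?_ ?_ ?_ ?_ ?_
  · intro f hf; simpa [degree_C_mul hc] using hf
  · intro f hf; simpa [degree_C_mul (inv_ne_zero hc)] using hf
  · intro f _; simp [← mul_assoc, ← C_mul, hc]
  · intro f _; simp [← mul_assoc, ← C_mul, hc]
  · intro f _; rfl

theorem sum_polysDegreeLT_add {M : Type*} [AddCommMonoid M] (n : ℕ) {a : F[X]}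
    (ha : a.degree < n) (H : F[X] → M) :
    ∑ f ∈ polysDegreeLT F n, H (f + a) = ∑ f ∈ polysDegreeLT F n, H f := by
  refine Finset.sum_nbij' (fun f => f + a) (fun f => f - a) ?_ ?_ ?_ ?_ ?_
  · intro f hf
    exact mem_polysDegreeLT.2 ((degree_add_le _ _).trans_lt (max_lt (mem_polysDegreeLT.1 hf) ha))
  · intro f hf
    exact mem_polysDegreeLT.2 ((degree_sub_le _ _).trans_lt (max_lt (mem_polysDegreeLT.1 hf) ha))
  · intro f _; simp
  · intro f _; simp
  · intro f _; rfl

/-- Multiplication by a unit modulo `D` permutes the residues modulo `D`. -/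
theorem sum_polysDegreeLT_mul {M : Type*} [AddCommMonoid M] {D f : F[X]} (hD : D.Monic)
    (hf : IsCoprime D f) (H : F[X] → M) (hH : ∀ u, H (u %ₘ D) = H u) :
    ∑ u ∈ polysDegreeLT F D.natDegree, H (u * f) = ∑ u ∈ polysDegreeLT F D.natDegree, H u := by
  have hlt (u : F[X]) : (u %ₘ D).degree < D.natDegree := by
    rw [← degree_eq_natDegree hD.ne_zero]
    exact degree_modByMonic_lt u hD
  have hself {u : F[X]} (hu : u ∈ polysDegreeLT F D.natDegree) : u %ₘ D = u := by
    rw [mem_polysDegreeLT, ← degree_eq_natDegree hD.ne_zero] at hu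
    exact (modByMonic_eq_self_iff hD).2 hu
  obtain ⟨a, b, hab⟩ := hf
  have key (u : F[X]) (hu : u ∈ polysDegreeLT F D.natDegree) (s t : F[X]) (hst : s * t = b * f) :
      ((u * s %ₘ D) * t) %ₘ D = u := by
    conv_rhs => rw [← hself hu]
    rw [← sub_eq_zero, ← sub_modByMonic, modByMonic_eq_zero_iff_dvd hD]
    have h1 : D ∣ u * s %ₘ D - u * s := by
      rw [modByMonic_eq_sub_mul_div, sub_sub_cancel_left, dvd_neg]
      exact dvd_mul_right _ _
    obtain ⟨w, hw⟩ := h1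
    exact ⟨w * t - u * a, by linear_combination t * hw + u * hst + u * hab⟩
  refine Finset.sum_nbij' (fun u => (u * f) %ₘ D) (fun u => (u * b) %ₘ D) ?_ ?_ ?_ ?_ ?_
  · intro u _; exact mem_polysDegreeLT.2 (hlt _)
  · intro u _; exact mem_polysDegreeLT.2 (hlt _)
  · intro u hu; exact key u hu f b (mul_comm _ _)
  · intro u hu; exact key u hu b f rfl
  · intro u _; exact (hH _).symm

/-- The Chinese remainder theorem as a change of variables. -/
theorem sum_polysDegreeLT_crt {M : Type*} [AddCommMonoid M] {A B : F[X]} (hA : A.Monic)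
    (hB : B.Monic) (hAB : IsCoprime A B) (H : F[X] → M) :
    ∑ u ∈ polysDegreeLT F (A * B).natDegree, H u =
      ∑ a ∈ polysDegreeLT F A.natDegree, ∑ b ∈ polysDegreeLT F B.natDegree,
        H (a * B + b * A) := by
  classical
  rw [← Finset.sum_product']
  have hmem (p : F[X] × F[X])
      (hp : p ∈ polysDegreeLT F A.natDegree ×ˢ polysDegreeLT F B.natDegree) :
      p.1 * B + p.2 * A ∈ polysDegreeLT F (A * B).natDegree := by
    obtain ⟨h1, h2⟩ := Finset.mem_product.1 hp
    rw [mem_polysDegreeLT] at h1 h2 ⊢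
    rw [← degree_eq_natDegree hA.ne_zero] at h1
    rw [← degree_eq_natDegree hB.ne_zero] at h2
    rw [← degree_eq_natDegree (hA.mul hB).ne_zero, degree_mul]
    refine (degree_add_le _ _).trans_lt (max_lt ?_ ?_)
    · rw [degree_mul, degree_eq_natDegree hB.ne_zero]
      exact WithBot.add_lt_add_right (by simp) h1
    · rw [degree_mul, add_comm, degree_eq_natDegree hA.ne_zero]
      exact WithBot.add_lt_add_left (by simp) h2
  have hinj : Set.InjOn (fun p : F[X] × F[X] => p.1 * B + p.2 * A)
      (polysDegreeLT F A.natDegree ×ˢ polysDegreeLT F B.natDegree : Finset (F[X] × F[X])) := by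
    have aux {A B a a' b b' : F[X]} (hA : A.Monic) (hAB : IsCoprime A B)
        (ha : a.degree < A.natDegree) (ha' : a'.degree < A.natDegree)
        (h : a * B + b * A = a' * B + b' * A) : a = a' := by
      have hd : A ∣ a - a' := by
        refine hAB.dvd_of_dvd_mul_right (z := B) ⟨b' - b, ?_⟩
        linear_combination h
      rw [← sub_eq_zero]
      refine eq_zero_of_dvd_of_degree_lt hd ?_
      rw [degree_eq_natDegree hA.ne_zero]
      exact (degree_sub_le _ _).trans_lt (max_lt ha ha')
    rintro ⟨a, b⟩ h ⟨a', b'⟩ h' heq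
    obtain ⟨h1, h2⟩ := Finset.mem_product.1 h
    obtain ⟨h1', h2'⟩ := Finset.mem_product.1 h'
    simp only [mem_polysDegreeLT] at h1 h2 h1' h2' heq
    refine Prod.ext (aux hA hAB h1 h1' heq) (aux hB hAB.symm h2 h2' (b := a) (b' := a') ?_)
    linear_combination heq
  have himg := Finset.eq_of_subset_of_card_le (Finset.image_subset_iff.2 hmem) (by
    rw [Finset.card_image_of_injOn hinj, Finset.card_product, card_polysDegreeLT,
      card_polysDegreeLT, card_polysDegreeLT, hA.natDegree_mul hB, pow_add])
  rw [← himg, Finset.sum_image hinj]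

/-! ### The character attached to a monic polynomial -/

/-- The resultant of a monic irreducible polynomial `P` and `f` is the norm of `f` in the
residue field of `P`. -/
theorem resultant_eq_norm {P : F[X]} (hP : P.Monic) [Fact (Irreducible P)] (f : F[X]) :
    resultant P f = Algebra.norm F (AdjoinRoot.mk P f) := by
  have : FiniteDimensional F (AdjoinRoot P) := (AdjoinRoot.powerBasis hP.ne_zero).finite
  let E := AlgebraicClosure F
  apply (algebraMap F E).injective
  have hirr : Irreducible P := Fact.out
  have hmp : minpoly F (AdjoinRoot.root P) = P := by
    rw [AdjoinRoot.minpoly_root hP.ne_zero, hP.leadingCoeff, inv_one, C_1, mul_one]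
  rw [Algebra.norm_eq_prod_embeddings F E, ← resultant_map_map,
    ← hP.natDegree_map (algebraMap F E), resultant_eq_prod_eval _ _ _ natDegree_map_le
      (IsAlgClosed.splits _), (hP.map _).leadingCoeff, one_pow, one_mul]
  have hnd : (P.map (algebraMap F E)).roots.Nodup :=
    nodup_roots ((PerfectField.separable_of_irreducible hirr).map)
  have hprod : ((P.map (algebraMap F E)).roots.map (eval · (f.map (algebraMap F E)))).prod =
      ∏ x ∈ (⟨(P.map (algebraMap F E)).roots, hnd⟩ : Finset E), eval x (f.map (algebraMap F E)) :=
    rfl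
  rw [hprod, ← Finset.prod_coe_sort]
  symm
  refine Finset.prod_equiv (AdjoinRoot.equiv E F P hP.ne_zero) (by simp) fun σ _ => ?_
  rw [← AdjoinRoot.aeval_eq, ← Polynomial.aeval_algHom_apply, eval_map_algebraMap]
  rfl

variable [DecidableEq F]

/-- The quadratic character of the resultant of `D` and `f`; for monic `D` this is the Jacobi
symbol of `f` modulo `D`. -/
noncomputable def resChar (D f : F[X]) : ℤ := quadraticChar F (resultant D f)

theorem resChar_mul_right {D : F[X]} (hD : D.Monic) (f g : F[X]) :
    resChar D (f * g) = resChar D f * resChar D g := by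
  rw [resChar, resChar, resChar, ← map_mul, ← resultant_mul_right _ _ _ _ le_rfl,
    resultant_eq_of_natDegree_le hD natDegree_mul_le]

theorem resChar_mul_left {A B : F[X]} (hA : A.Monic) (hB : B.Monic) (f : F[X]) :
    resChar (A * B) f = resChar A f * resChar B f := by
  rw [resChar, resChar, resChar, ← map_mul, ← resultant_mul_left _ _ _ _ le_rfl,
    hA.natDegree_mul hB]

theorem resChar_add_mul {D : F[X]} (hD : D.Monic) (f p : F[X]) :
    resChar D (f + D * p) = resChar D f := by
  rw [resChar, resChar,
    ← resultant_eq_of_natDegree_le (f := f + D * p)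
      (n := max f.natDegree (p.natDegree + D.natDegree))
      hD ?_, resultant_add_mul_right _ _ _ _ _ (le_max_right _ _) le_rfl,
    resultant_eq_of_natDegree_le hD (le_max_left _ _)]
  refine (natDegree_add_le _ _).trans (max_le_max le_rfl ?_)
  rw [add_comm]
  exact natDegree_mul_le

theorem resChar_modByMonic {D : F[X]} (hD : D.Monic) (f : F[X]) :
    resChar D (f %ₘ D) = resChar D f := by
  conv_rhs => rw [← modByMonic_add_div f D]
  exact (resChar_add_mul hD _ _).symm

theorem resChar_C (D : F[X]) (c : F) :
    resChar D (C c) = quadraticChar F c ^ D.natDegree := by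
  rw [resChar, ← map_pow]
  simp

theorem resChar_one_right (D : F[X]) : resChar D 1 = 1 := by
  rw [← C_1, resChar_C, map_one, one_pow]

theorem resChar_one_left (f : F[X]) : resChar 1 f = 1 := by
  simp [resChar]

theorem resChar_eq_zero {D f : F[X]} (hD : D.Monic) (h : ¬ IsCoprime D f) : resChar D f = 0 := by
  rw [resChar, quadraticChar_eq_zero_iff, resultant_eq_zero_iff]
  exact ⟨Or.inl hD.ne_zero, h⟩

theorem resChar_mul_self {D f : F[X]} (h : IsCoprime D f) :
    resChar D f * resChar D f = 1 := by
  rw [resChar, ← sq]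
  refine quadraticChar_sq_one ?_
  rw [Ne, resultant_eq_zero_iff]
  exact fun h' => h'.2 h

/-- Quadratic reciprocity when `-1` is a square. -/
theorem resChar_comm (h : quadraticChar F (-1) = 1) (A B : F[X]) : resChar A B = resChar B A := by
  rw [resChar, resultant_comm, map_mul, map_pow, h, one_pow, one_mul, resChar]

theorem resChar_prod_right {D : F[X]} (hD : D.Monic) {ι : Type*} (s : Finset ι) (t : ι → F[X]) :
    resChar D (∏ i ∈ s, t i) = ∏ i ∈ s, resChar D (t i) := by
  classical
  induction s using Finset.induction_on with
  | empty => simp [resChar_one_right D]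
  | insert a s ha ih => rw [Finset.prod_insert ha, Finset.prod_insert ha, resChar_mul_right hD, ih]

/-- The quadratic character of an extension of finite fields factors through the norm. -/
theorem quadraticChar_norm (hF : ringChar F ≠ 2) {K : Type*} [Field K] [Fintype K] [DecidableEq K]
    [Algebra F K] (x : K) : quadraticChar F (Algebra.norm F x) = quadraticChar K x := by
  by_cases hx : x = 0
  · rw [hx, quadraticChar_zero, Algebra.norm_zero, quadraticChar_zero]
  have hsq {y : K} (hy : y ≠ 0) (h : IsSquare y) : quadraticChar F (Algebra.norm F y) = 1 :=
    (quadraticChar_one_iff_isSquare (Algebra.norm_ne_zero_iff.2 hy)).2 (h.map _)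
  by_cases h : IsSquare x
  · rw [hsq hx h, (quadraticChar_one_iff_isSquare hx).2 h]
  · obtain ⟨a, ha⟩ := quadraticChar_exists_neg_one hF
    obtain ⟨y, rfl⟩ := FiniteField.norm_surjective F K a
    have hy0 : y ≠ 0 := by
      rintro rfl
      simp [Algebra.norm_zero] at ha
    have hy : ¬ IsSquare y := fun hy => by simp [hsq hy0 hy] at ha
    have hxy : IsSquare (x * y) := by
      rw [← quadraticChar_one_iff_isSquare (mul_ne_zero hx hy0), map_mul,
        quadraticChar_neg_one_iff_not_isSquare.2 h, quadraticChar_neg_one_iff_not_isSquare.2 hy]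
      norm_num
    have := hsq (mul_ne_zero hx hy0) hxy
    rw [map_mul, map_mul, ha] at this
    rw [quadraticChar_neg_one_iff_not_isSquare.2 h]
    linarith

theorem resChar_eq_quadraticChar (hF : ringChar F ≠ 2) {P : F[X]} (hP : P.Monic)
    [Fact (Irreducible P)] [Fintype (AdjoinRoot P)] [DecidableEq (AdjoinRoot P)] (f : F[X]) :
    resChar P f = quadraticChar (AdjoinRoot P) (AdjoinRoot.mk P f) := by
  rw [resChar, resultant_eq_norm hP, quadraticChar_norm hF]

/-! ### Gauss sums -/

section GaussSums

variable (e : AddChar F ℂ)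

/-- Low degree polynomials are their own annihilators, up to complementing the degree. -/
theorem sum_residueChar_mul (he : e.IsPrimitive) {D u : F[X]} (hD : D.Monic)
    (hu : u.degree < D.natDegree) {n m : ℕ} (hnm : n + m = D.natDegree) :
    ∑ b ∈ polysDegreeLT F n, residueChar e D (u * b) =
      if u ∈ polysDegreeLT F m then (Fintype.card F : ℂ) ^ n else 0 := by
  split_ifs with h
  · rw [mem_polysDegreeLT] at h
    rw [Finset.sum_congr rfl (g := fun _ => (1 : ℂ)), Finset.sum_const, card_polysDegreeLT]
    · simp
    intro b hb
    rw [mem_polysDegreeLT] at hb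
    by_cases hub : u * b = 0
    · rw [hub, residueChar_zero]
    have hu0 := left_ne_zero_of_mul hub
    have hb0 := right_ne_zero_of_mul hub
    rw [degree_eq_natDegree hu0] at h
    rw [degree_eq_natDegree hb0] at hb
    have h : u.natDegree < m := by exact_mod_cast h
    have hb : b.natDegree < n := by exact_mod_cast hb
    have hd : (u * b).natDegree = u.natDegree + b.natDegree := natDegree_mul hu0 hb0
    rw [residueChar_of_degree_lt e hD, coeff_eq_zero_of_natDegree_lt (by omega),
      AddChar.map_zero_eq_one]
    rw [degree_eq_natDegree hub]
    exact_mod_cast (by omega)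
  · have hu0 : u ≠ 0 := by rintro rfl; simp at h
    rw [mem_polysDegreeLT, degree_eq_natDegree hu0, Nat.cast_lt, not_lt] at h
    rw [degree_eq_natDegree hu0, Nat.cast_lt] at hu
    have hne : e.mulShift u.leadingCoeff ≠ 1 := he (leadingCoeff_ne_zero.2 hu0)
    obtain ⟨c, hc⟩ := (AddChar.ne_one_iff).1 hne
    rw [AddChar.mulShift_apply] at hc
    set b₀ : F[X] := C c * X ^ (D.natDegree - 1 - u.natDegree) with hb₀
    have hb₀n : b₀.degree < n :=
      (degree_C_mul_X_pow_le _ _).trans_lt (by exact_mod_cast (by omega))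
    have hval : residueChar e D (u * b₀) = e (u.leadingCoeff * c) := by
      rw [residueChar_of_degree_lt e hD]
      · rw [hb₀, ← mul_assoc, mul_comm u, mul_assoc, coeff_C_mul, coeff_mul_X_pow']
        rw [if_pos (by omega), show D.natDegree - 1 - (D.natDegree - 1 - u.natDegree) =
          u.natDegree by omega, coeff_natDegree, mul_comm]
      · rw [degree_lt_iff_coeff_zero]
        intro k hk
        rw [hb₀, ← mul_assoc, mul_comm u, mul_assoc, coeff_C_mul, coeff_mul_X_pow',
          if_pos (by omega), coeff_eq_zero_of_natDegree_lt (by omega), mul_zero]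
    have hshift := sum_polysDegreeLT_add n hb₀n fun b => residueChar e D (u * b)
    simp only [mul_add, residueChar_add, hval, ← Finset.sum_mul] at hshift
    by_contra h0
    exact hc (mul_left_cancel₀ h0 (by rw [hshift, mul_one]))

/-- The quadratic Gauss sum of a finite field. -/
noncomputable def quadGaussSum : ℂ := ∑ c : F, (quadraticChar F c : ℂ) * e c

theorem quadGaussSum_sq (hF : ringChar F ≠ 2) (h : quadraticChar F (-1) = 1)
    (he : e.IsPrimitive) : quadGaussSum e ^ 2 = Fintype.card F := by
  have hinj : Function.Injective (Int.castRingHom ℂ) := Int.cast_injective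
  have h1 : (quadraticChar F).ringHomComp (Int.castRingHom ℂ) ≠ 1 :=
    (MulChar.ringHomComp_ne_one_iff hinj).2 (quadraticChar_ne_one hF)
  have h2 := gaussSum_sq h1 ((quadraticChar_isQuadratic F).comp (Int.castRingHom ℂ)) he
  rw [MulChar.ringHomComp_apply, h, map_one, one_mul] at h2
  rw [← h2]
  rfl

/-- Summing over squares amounts to twisting by the quadratic character. -/
theorem sum_comp_sq {K : Type*} [Field K] [Fintype K] [DecidableEq K] (hK : ringChar K ≠ 2)
    (ψ : K → ℂ) (hψ : ∑ x, ψ x = 0) :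
    ∑ x, ψ (x ^ 2) = ∑ y, (quadraticChar K y : ℂ) * ψ y := by
  have h (y : K) : ∑ x : K with x ^ 2 = y, ψ (x ^ 2) = ((quadraticChar K y : ℂ) + 1) * ψ y := by
    rw [Finset.sum_congr rfl (g := fun _ => ψ y) fun x hx => by rw [(Finset.mem_filter.1 hx).2],
      Finset.sum_const, nsmul_eq_mul]
    congr 1
    have := quadraticChar_card_sqrts hK y
    rw [Set.toFinset_ofPred] at this
    exact_mod_cast this
  rw [← Finset.sum_fiberwise Finset.univ (fun x : K => x ^ 2)]
  simp only [h, add_mul, one_mul, Finset.sum_add_distrib, hψ, add_zero]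

theorem sum_addChar_sq (hF : ringChar F ≠ 2) (he : e.IsPrimitive) :
    ∑ c : F, e (c ^ 2) = quadGaussSum e := by
  refine sum_comp_sq hF e (AddChar.sum_eq_zero_of_ne_one ?_)
  simpa using he one_ne_zero

theorem sum_residueChar_sq (hF : ringChar F ≠ 2) (h : quadraticChar F (-1) = 1)
    (he : e.IsPrimitive) {D : F[X]} (hD : D.Monic) :
    ∑ y ∈ polysDegreeLT F D.natDegree, residueChar e D (y * y) =
      quadGaussSum e ^ D.natDegree := by
  have h2 : (2 : F) ≠ 0 := Ring.two_ne_zero hF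
  have hq : (Fintype.card F : ℂ) ≠ 0 := by simp
  obtain ⟨m, n, hn, hmn⟩ : ∃ m n, 2 * m ≤ D.natDegree ∧ m + n = D.natDegree ∧ n ≤ m + 1 :=
    ⟨D.natDegree / 2, D.natDegree - D.natDegree / 2, by omega, by omega, by omega⟩
  have key : ∑ y ∈ polysDegreeLT F D.natDegree, residueChar e D (y * y) =
      ∑ y ∈ polysDegreeLT F n, residueChar e D (y * y) := by
    have hsub : polysDegreeLT F n ⊆ polysDegreeLT F D.natDegree := fun y hy =>
      mem_polysDegreeLT.2 ((mem_polysDegreeLT.1 hy).trans_le (by exact_mod_cast (by omega)))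
    refine mul_left_cancel₀ (pow_ne_zero m hq) ?_
    calc (Fintype.card F : ℂ) ^ m * ∑ y ∈ polysDegreeLT F D.natDegree, residueChar e D (y * y)
        = ∑ b ∈ polysDegreeLT F m, ∑ y ∈ polysDegreeLT F D.natDegree,
            residueChar e D (y * y) * residueChar e D (y * (C 2 * b)) := by
          rw [← Nat.cast_pow, ← card_polysDegreeLT, ← nsmul_eq_mul, ← Finset.sum_const]
          refine Finset.sum_congr rfl fun b hb => ?_
          rw [mem_polysDegreeLT] at hb
          rw [← sum_polysDegreeLT_add D.natDegree (a := b)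
            (hb.trans_le (by exact_mod_cast (by omega)))]
          refine Finset.sum_congr rfl fun y _ => ?_
          rw [show (y + b) * (y + b) = y * y + y * (C 2 * b) + b * b by
            rw [show (C 2 : F[X]) = 2 from rfl]; ring, residueChar_add, residueChar_add,
            residueChar_sq_eq_one e hD hb hn, mul_one]
      _ = ∑ y ∈ polysDegreeLT F D.natDegree, residueChar e D (y * y) *
            ∑ b ∈ polysDegreeLT F m, residueChar e D (y * b) := by
          rw [Finset.sum_comm]
          refine Finset.sum_congr rfl fun y _ => ?_
          rw [← Finset.mul_sum, sum_polysDegreeLT_C_mul m h2 fun b => residueChar e D (y * b)]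
      _ = ∑ y ∈ polysDegreeLT F D.natDegree, if y ∈ polysDegreeLT F n then
            (Fintype.card F : ℂ) ^ m * residueChar e D (y * y) else 0 := by
          refine Finset.sum_congr rfl fun y hy => ?_
          rw [sum_residueChar_mul e he hD (mem_polysDegreeLT.1 hy) hmn.1, mul_ite, mul_zero,
            mul_comm]
      _ = (Fintype.card F : ℂ) ^ m * ∑ y ∈ polysDegreeLT F n, residueChar e D (y * y) := by
          rw [Finset.sum_ite_mem, Finset.inter_eq_right.2 hsub, Finset.mul_sum]
  rw [key]
  have hτ := quadGaussSum_sq e hF h he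
  rcases (show n = m ∨ n = m + 1 by omega) with rfl | rfl
  · rw [Finset.sum_congr rfl fun y hy => residueChar_sq_eq_one e hD (mem_polysDegreeLT.1 hy) hn,
      ← hmn.1, ← two_mul, pow_mul, hτ]
    simp [card_polysDegreeLT]
  · have hN : D.natDegree = 2 * m + 1 := by omega
    have hval (c : F) (b : F[X]) (hb : b ∈ polysDegreeLT F m) :
        residueChar e D ((C c * X ^ m + b) * (C c * X ^ m + b)) = e (c ^ 2) := by
      rw [mem_polysDegreeLT] at hb
      have hy : (C c * X ^ m + b).natDegree ≤ m :=
        natDegree_add_le_of_degree_le (natDegree_C_mul_X_pow_le c m)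
          (natDegree_le_of_degree_le hb.le)
      have hyy : ((C c * X ^ m + b) * (C c * X ^ m + b)).natDegree ≤ m + m :=
        natDegree_mul_le_of_le hy hy
      rw [residueChar_of_degree_lt e hD, hN, show 2 * m + 1 - 1 = m + m by omega,
        coeff_mul_add_eq_of_natDegree_le hy hy]
      · simp [coeff_eq_zero_of_degree_lt hb, sq]
      · refine degree_le_natDegree.trans_lt ?_
        exact_mod_cast (by omega)
    rw [sum_polysDegreeLT_succ]
    rw [Finset.sum_congr rfl fun c _ => Finset.sum_congr rfl (hval c), hN, pow_succ, pow_mul, hτ,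
      ← sum_addChar_sq e hF he, Finset.mul_sum]
    simp [card_polysDegreeLT]

/-- The Gauss sum of a monic irreducible polynomial, with trivial twist. -/
theorem sum_resChar_mul_residueChar_of_irreducible (hF : ringChar F ≠ 2)
    (h : quadraticChar F (-1) = 1) (he : e.IsPrimitive) {P : F[X]} (hP : P.Monic)
    (hirr : Irreducible P) :
    ∑ u ∈ polysDegreeLT F P.natDegree, (resChar P u : ℂ) * residueChar e P u =
      quadGaussSum e ^ P.natDegree := by
  classical
  have : Fact (Irreducible P) := ⟨hirr⟩
  have : FiniteDimensional F (AdjoinRoot P) := (AdjoinRoot.powerBasis hP.ne_zero).finite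
  have : Finite (AdjoinRoot P) := Module.finite_of_finite F
  let _ : Fintype (AdjoinRoot P) := Fintype.ofFinite _
  have hdeg {u : F[X]} (hu : u ∈ polysDegreeLT F P.natDegree) : u %ₘ P = u := by
    rw [mem_polysDegreeLT, ← degree_eq_natDegree hP.ne_zero] at hu
    exact (modByMonic_eq_self_iff hP).2 hu
  have transfer (H : AdjoinRoot P → ℂ) :
      ∑ u ∈ polysDegreeLT F P.natDegree, H (AdjoinRoot.mk P u) = ∑ x, H x := by
    refine Finset.sum_nbij' (AdjoinRoot.mk P) (AdjoinRoot.modByMonicHom hP) ?_ ?_ ?_ ?_ ?_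
    · intro u _; exact Finset.mem_univ _
    · intro x _
      obtain ⟨u, rfl⟩ := AdjoinRoot.mk_surjective x
      rw [AdjoinRoot.modByMonicHom_mk, mem_polysDegreeLT, ← degree_eq_natDegree hP.ne_zero]
      exact degree_modByMonic_lt u hP
    · intro u hu
      rw [AdjoinRoot.modByMonicHom_mk, hdeg hu]
    · intro x _; exact AdjoinRoot.mk_leftInverse hP x
    · intro u _; rfl
  let ψ (x : AdjoinRoot P) : ℂ := residueChar e P (AdjoinRoot.modByMonicHom hP x)
  have hψ (u : F[X]) : ψ (AdjoinRoot.mk P u) = residueChar e P u := by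
    rw [← residueChar_modByMonic e hP u, ← AdjoinRoot.modByMonicHom_mk hP]
  have hK : ringChar (AdjoinRoot P) ≠ 2 := by
    rwa [← Algebra.ringChar_eq F (AdjoinRoot P)]
  have h0 : ∑ x, ψ x = 0 := by
    rw [← transfer]
    simp only [hψ]
    have h1 : (1 : F[X]).degree < P.natDegree := by
      rw [degree_one]
      exact_mod_cast hirr.natDegree_pos
    have := sum_residueChar_mul e he hP h1 (add_zero P.natDegree)
    simpa [polysDegreeLT_zero] using this
  have hsq := sum_comp_sq hK ψ h0
  rw [← transfer, ← transfer] at hsq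
  simp only [← map_pow, hψ, ← resChar_eq_quadraticChar hF hP] at hsq
  rw [← hsq, ← sum_residueChar_sq e hF h he hP]
  simp only [sq]

theorem sum_resChar_mul_residueChar_mul_irreducible (hF : ringChar F ≠ 2)
    (h : quadraticChar F (-1) = 1) (he : e.IsPrimitive) {P : F[X]} (hP : P.Monic)
    (hirr : Irreducible P) (f : F[X]) :
    ∑ u ∈ polysDegreeLT F P.natDegree, (resChar P u : ℂ) * residueChar e P (u * f) =
      resChar P f * quadGaussSum e ^ P.natDegree := by
  by_cases hf : IsCoprime P f
  · rw [← sum_resChar_mul_residueChar_of_irreducible e hF h he hP hirr,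
      ← sum_polysDegreeLT_mul hP hf (fun u => (resChar P u : ℂ) * residueChar e P u) fun u => by
        rw [resChar_modByMonic hP, residueChar_modByMonic e hP], Finset.mul_sum]
    · refine Finset.sum_congr rfl fun u _ => ?_
      rw [resChar_mul_right hP, Int.cast_mul]
      have := resChar_mul_self hf
      have : (resChar P f : ℂ) * resChar P f = 1 := by exact_mod_cast this
      linear_combination (-(resChar P u : ℂ) * residueChar e P (u * f)) * this
  · have hdvd : P ∣ f := (hirr.coprime_iff_not_dvd.not_left).1 hf
    rw [resChar_eq_zero hP hf, Int.cast_zero, zero_mul]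
    have h1 (u : F[X]) : residueChar e P (u * f) = 1 := by
      rw [residueChar_eq_of_dvd_sub e hP (g := 0) (by simpa using hdvd.mul_left u),
        residueChar_zero]
    simp only [h1, mul_one]
    obtain ⟨u₀, hu₀⟩ : ∃ u₀, resChar P u₀ = -1 := by
      classical
      have : Fact (Irreducible P) := ⟨hirr⟩
      have : FiniteDimensional F (AdjoinRoot P) := (AdjoinRoot.powerBasis hP.ne_zero).finite
      have : Finite (AdjoinRoot P) := Module.finite_of_finite F
      let _ : Fintype (AdjoinRoot P) := Fintype.ofFinite _
      have hK : ringChar (AdjoinRoot P) ≠ 2 := by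
        rwa [← Algebra.ringChar_eq F (AdjoinRoot P)]
      obtain ⟨a, ha⟩ := quadraticChar_exists_neg_one hK
      obtain ⟨u, rfl⟩ := AdjoinRoot.mk_surjective a
      exact ⟨u, by rw [resChar_eq_quadraticChar hF hP, ha]⟩
    have hc : IsCoprime P u₀ := by
      by_contra hc
      rw [resChar_eq_zero hP hc] at hu₀
      norm_num at hu₀
    have := sum_polysDegreeLT_mul hP hc (fun u => (resChar P u : ℂ))
      fun u => by rw [resChar_modByMonic hP]
    simp only [resChar_mul_right hP, hu₀, Int.cast_mul, ← Finset.sum_mul] at this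
    push_cast at this
    linear_combination (-1 / 2 : ℂ) * this

/-- The Gauss sum of a squarefree monic polynomial. -/
theorem sum_resChar_mul_residueChar_mul (hF : ringChar F ≠ 2)
    (h : quadraticChar F (-1) = 1) (he : e.IsPrimitive) {D : F[X]} (hD : D.Monic)
    (hsf : Squarefree D) (f : F[X]) :
    ∑ u ∈ polysDegreeLT F D.natDegree, (resChar D u : ℂ) * residueChar e D (u * f) =
      resChar D f * quadGaussSum e ^ D.natDegree := by
  induction hn : D.natDegree using Nat.strong_induction_on generalizing D with
  | _ n ih =>
  subst hn
  by_cases hu : IsUnit D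
  · rw [hD.eq_one_of_isUnit hu]
    simp [polysDegreeLT_zero, resChar_one_left, residueChar_zero]
  obtain ⟨P, hP, hirr, hdvd⟩ : ∃ P : F[X], P.Monic ∧ Irreducible P ∧ P ∣ D := by
    obtain ⟨P, h1, h2, h3⟩ := exists_monic_irreducible_factor D hu
    exact ⟨P, h1, h2, h3⟩
  obtain ⟨B, rfl⟩ := hdvd
  have hB : B.Monic := hP.of_mul_monic_left hD
  have hPB : IsCoprime P B := by
    rw [hirr.coprime_iff_not_dvd]
    rintro ⟨w, rfl⟩
    exact hirr.not_isUnit (hsf P ⟨w, by ring⟩)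
  have ihB := ih B.natDegree (by rw [hP.natDegree_mul hB]; have := hirr.natDegree_pos; omega) hB
    hsf.of_mul_right rfl
  have ihP := sum_resChar_mul_residueChar_mul_irreducible e hF h he hP hirr f
  have hcross : (resChar P B : ℂ) * resChar B P = 1 := by
    rw [resChar_comm h B P]
    exact_mod_cast resChar_mul_self hPB
  rw [sum_polysDegreeLT_crt hP hB hPB, resChar_mul_left hP hB, hP.natDegree_mul hB, pow_add]
  calc _ = ∑ a ∈ polysDegreeLT F P.natDegree, ∑ b ∈ polysDegreeLT F B.natDegree,
        (resChar P a * residueChar e P (a * f)) * (resChar B b * residueChar e B (b * f)) := by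
        refine Finset.sum_congr rfl fun a _ => Finset.sum_congr rfl fun b _ => ?_
        have h1 : resChar P (a * B + b * P) = resChar P a * resChar P B := by
          rw [mul_comm b, resChar_add_mul hP, resChar_mul_right hP]
        have h2 : resChar B (a * B + b * P) = resChar B b * resChar B P := by
          rw [add_comm, mul_comm a, resChar_add_mul hB, resChar_mul_right hB]
        have h3 : residueChar e (P * B) ((a * B + b * P) * f) =
            residueChar e P (a * f) * residueChar e B (b * f) := by
          rw [show (a * B + b * P) * f = a * f * B + b * f * P by ring, residueChar_add,
            residueChar_mul_left e hP hB, mul_comm P B, residueChar_mul_left e hB hP]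
        rw [resChar_mul_left hP hB, h1, h2, h3]
        push_cast
        linear_combination (resChar P a * residueChar e P (a * f) *
          (resChar B b * residueChar e B (b * f)) : ℂ) * hcross
    _ = _ := by
        rw [← Finset.sum_mul_sum, ihP, ihB]
        push_cast
        ring

/-! ### The functional equation -/

theorem sum_resChar_eq_zero (hF : ringChar F ≠ 2) (h : quadraticChar F (-1) = 1)
    (he : e.IsPrimitive) {D : F[X]} (hD : D.Monic) (hsf : Squarefree D) (hpos : 0 < D.natDegree) :
    ∑ u ∈ polysDegreeLT F D.natDegree, resChar D u = 0 := by
  have h0 := sum_resChar_mul_residueChar_mul e hF h he hD hsf 0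
  have hz : resChar D 0 = 0 := by
    rw [← C_0, resChar_C, quadraticChar_zero, zero_pow hpos.ne']
  simp only [mul_zero, residueChar_zero, mul_one, hz, Int.cast_zero, zero_mul] at h0
  exact_mod_cast h0

/-- The coefficients of the `L`-function vanish from the degree of the modulus on. -/
theorem sum_monicsOfDegree_resChar_eq_zero (hF : ringChar F ≠ 2) (h : quadraticChar F (-1) = 1)
    (he : e.IsPrimitive) {D : F[X]} (hD : D.Monic) (hsf : Squarefree D) (hpos : 0 < D.natDegree)
    {n : ℕ} (hn : D.natDegree ≤ n) :
    ∑ f ∈ monicsOfDegree F n, resChar D f = 0 := by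
  have key (m : ℕ) :
      ∀ a : F[X], ∑ b ∈ polysDegreeLT F (D.natDegree + m), resChar D (a + b) = 0 := by
    induction m with
    | zero =>
      intro a
      have ha : (a %ₘ D).degree < D.natDegree := by
        rw [← degree_eq_natDegree hD.ne_zero]
        exact degree_modByMonic_lt a hD
      rw [← sum_resChar_eq_zero e hF h he hD hsf hpos, add_zero,
        ← sum_polysDegreeLT_add D.natDegree ha fun b => resChar D b]
      refine Finset.sum_congr rfl fun b _ => ?_
      rw [← resChar_add_mul hD (b + a %ₘ D) (a /ₘ D), add_assoc, modByMonic_add_div, add_comm]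
    | succ m ih =>
      intro a
      rw [← add_assoc, sum_polysDegreeLT_succ]
      refine Finset.sum_eq_zero fun c _ => ?_
      rw [← ih (a + C c * X ^ (D.natDegree + m))]
      simp only [add_assoc]
  obtain ⟨m, rfl⟩ := Nat.exists_eq_add_of_le hn
  rw [sum_monicsOfDegree, key]

theorem sum_resChar_C_mul_X_pow_add (hF : ringChar F ≠ 2) {D : F[X]} (hD : D.Monic)
    (hodd : Odd D.natDegree) (m : ℕ) (c : F) :
    ∑ b ∈ polysDegreeLT F m, resChar D (C c * X ^ m + b) =
      quadraticChar F c * ∑ f ∈ monicsOfDegree F m, resChar D f := by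
  have hC (t : F) : resChar D (C t) = quadraticChar F t := by
    rw [resChar_C]
    obtain ⟨j, hj⟩ := hodd
    rcases quadraticChar_isQuadratic F t with h | h | h <;> rw [h, hj] <;> simp [pow_succ, pow_mul]
  by_cases hc : c = 0
  · obtain ⟨t, ht⟩ := quadraticChar_exists_neg_one hF
    have ht0 : t ≠ 0 := by rintro rfl; simp at ht
    have := sum_polysDegreeLT_C_mul m ht0 fun b => resChar D b
    simp only [resChar_mul_right hD, hC, ht, neg_one_mul, Finset.sum_neg_distrib] at this
    simp only [hc, C_0, zero_mul, zero_add, quadraticChar_zero]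
    omega
  · rw [← sum_polysDegreeLT_C_mul m hc, sum_monicsOfDegree, Finset.mul_sum]
    simp only [← mul_add, resChar_mul_right hD, hC]

/-- The functional equation of the `L`-function of a monic squarefree polynomial of odd
degree. -/
theorem sum_monicsOfDegree_resChar_reflect (hF : ringChar F ≠ 2) (h : quadraticChar F (-1) = 1)
    (he : e.IsPrimitive) {D : F[X]} (hD : D.Monic) (hsf : Squarefree D) {g n m : ℕ}
    (hdeg : D.natDegree = 2 * g + 1) (hnm : n + m = 2 * g) :
    (Fintype.card F : ℂ) ^ g * ∑ f ∈ monicsOfDegree F n, (resChar D f : ℂ) =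
      (Fintype.card F : ℂ) ^ n * ∑ f ∈ monicsOfDegree F m, (resChar D f : ℂ) := by
  have hq : (Fintype.card F : ℂ) ≠ 0 := by simp
  have hτ := quadGaussSum_sq e hF h he
  have hτ0 : quadGaussSum e ≠ 0 := by
    intro h0
    rw [h0] at hτ
    exact hq (by simpa using hτ.symm)
  have hsub : polysDegreeLT F (m + 1) ⊆ polysDegreeLT F D.natDegree := fun y hy =>
    mem_polysDegreeLT.2 ((mem_polysDegreeLT.1 hy).trans_le (by exact_mod_cast (by omega)))
  refine mul_left_cancel₀ hτ0 ?_
  calc quadGaussSum e *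
        ((Fintype.card F : ℂ) ^ g * ∑ f ∈ monicsOfDegree F n, (resChar D f : ℂ))
      = ∑ f ∈ monicsOfDegree F n, (resChar D f : ℂ) * quadGaussSum e ^ D.natDegree := by
        rw [← Finset.sum_mul, hdeg, pow_succ, pow_mul, hτ]
        ring
    _ = ∑ b ∈ polysDegreeLT F n, ∑ u ∈ polysDegreeLT F D.natDegree,
          (resChar D u : ℂ) * residueChar e D (u * X ^ n) * residueChar e D (u * b) := by
        rw [sum_monicsOfDegree]
        refine Finset.sum_congr rfl fun b _ => ?_
        rw [← sum_resChar_mul_residueChar_mul e hF h he hD hsf]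
        refine Finset.sum_congr rfl fun u _ => ?_
        rw [mul_add, residueChar_add, mul_assoc]
    _ = ∑ u ∈ polysDegreeLT F D.natDegree, if u ∈ polysDegreeLT F (m + 1) then
          (Fintype.card F : ℂ) ^ n * (resChar D u * residueChar e D (u * X ^ n)) else 0 := by
        rw [Finset.sum_comm]
        refine Finset.sum_congr rfl fun u hu => ?_
        rw [← Finset.mul_sum, sum_residueChar_mul e he hD (mem_polysDegreeLT.1 hu)
          (show n + (m + 1) = D.natDegree by omega), mul_ite, mul_zero, mul_comm]
    _ = (Fintype.card F : ℂ) ^ n * ∑ u ∈ polysDegreeLT F (m + 1),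
          (resChar D u * residueChar e D (u * X ^ n) : ℂ) := by
        rw [Finset.sum_ite_mem, Finset.inter_eq_right.2 hsub, Finset.mul_sum]
    _ = (Fintype.card F : ℂ) ^ n * ∑ c : F, e c *
          ∑ b ∈ polysDegreeLT F m, (resChar D (C c * X ^ m + b) : ℂ) := by
        rw [sum_polysDegreeLT_succ]
        congr 1
        refine Finset.sum_congr rfl fun c _ => ?_
        rw [Finset.mul_sum]
        refine Finset.sum_congr rfl fun b hb => ?_
        rw [mem_polysDegreeLT] at hb
        rw [residueChar_of_degree_lt e hD (degree_C_mul_X_pow_add_mul_X_pow_lt (by omega) c hb),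
          show D.natDegree - 1 = m + n by omega, coeff_mul_X_pow, coeff_add, coeff_C_mul_X_pow,
          if_pos rfl, coeff_eq_zero_of_degree_lt hb, add_zero, mul_comm]
    _ = (Fintype.card F : ℂ) ^ n * ∑ c : F, ((quadraticChar F c : ℂ) * e c) *
          ∑ f ∈ monicsOfDegree F m, (resChar D f : ℂ) := by
        congr 1
        refine Finset.sum_congr rfl fun c _ => ?_
        have := sum_resChar_C_mul_X_pow_add hF hD (hdeg ▸ odd_two_mul_add_one g) m c
        have : ∑ b ∈ polysDegreeLT F m, (resChar D (C c * X ^ m + b) : ℂ) =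
          quadraticChar F c * ∑ f ∈ monicsOfDegree F m, (resChar D f : ℂ) := by exact_mod_cast this
        rw [this]
        ring
    _ = _ := by
        rw [← Finset.sum_mul, quadGaussSum]
        ring

end GaussSums

/-! ### Powers of the `L`-function -/

/-- The coefficients of the `k`-th power of a generating series over monic polynomials. -/
theorem coeff_pow_eq_sum_monicsOfDegree (p : ℂ[X]) (χ : F[X] → ℂ)
    (hp : ∀ n, p.coeff n = ∑ f ∈ monicsOfDegree F n, χ f) (k : ℕ)
    (hχ : ∀ t : Fin k → F[X], (∀ i, (t i).Monic) → χ (∏ i, t i) = ∏ i, χ (t i)) (m : ℕ) :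
    (p ^ k).coeff m = ∑ f ∈ monicsOfDegree F m,
      χ f * (Nat.card {t : Fin k → F[X] // (∀ i, (t i).Monic) ∧ ∏ i, t i = f} : ℂ) := by
  classical
  let U : Finset (Fin k → F[X]) := (Finset.univ.finsuppAntidiag m).biUnion fun l : Fin k →₀ ℕ =>
    Fintype.piFinset fun i => monicsOfDegree F (l i)
  have hU (t : Fin k → F[X]) : t ∈ U ↔ (∀ i, (t i).Monic) ∧ ∑ i, (t i).natDegree = m := by
    simp only [U, Finset.mem_biUnion, Finset.mem_finsuppAntidiag, Fintype.mem_piFinset,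
      mem_monicsOfDegree]
    constructor
    · rintro ⟨l, ⟨hl, -⟩, ht⟩
      exact ⟨fun i => (ht i).1, by rw [← hl]; exact Finset.sum_congr rfl fun i _ => (ht i).2⟩
    · rintro ⟨ht, hm⟩
      exact ⟨Finsupp.equivFunOnFinite.symm fun i => (t i).natDegree,
        ⟨by simpa using hm, Finset.subset_univ _⟩, fun i => ⟨ht i, by simp⟩⟩
  have h1 : (p ^ k).coeff m = ∑ t ∈ U, χ (∏ i, t i) := by
    rw [Finset.sum_biUnion]
    · rw [← Polynomial.coeff_coe, Polynomial.coe_pow, ← Fin.prod_const k (p : PowerSeries ℂ),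
        PowerSeries.coeff_prod]
      refine Finset.sum_congr rfl fun l _ => ?_
      simp only [Polynomial.coeff_coe, hp]
      rw [Finset.prod_univ_sum]
      refine Finset.sum_congr rfl fun t ht => (hχ t fun i => ?_).symm
      exact (mem_monicsOfDegree.1 (Fintype.mem_piFinset.1 ht i)).1
    · intro l _ l' _ hne
      refine Finset.disjoint_left.2 fun t ht ht' => hne (Finsupp.ext fun i => ?_)
      rw [← (mem_monicsOfDegree.1 (Fintype.mem_piFinset.1 ht i)).2,
        (mem_monicsOfDegree.1 (Fintype.mem_piFinset.1 ht' i)).2]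
  have hmaps : ∀ t ∈ U, ∏ i, t i ∈ monicsOfDegree F m := fun t ht => by
    obtain ⟨ht, hm⟩ := (hU t).1 ht
    exact mem_monicsOfDegree.2 ⟨monic_prod_of_monic _ _ fun i _ => ht i,
      by rw [natDegree_prod_of_monic _ _ fun i _ => ht i, hm]⟩
  rw [h1, ← Finset.sum_fiberwise_of_maps_to hmaps]
  refine Finset.sum_congr rfl fun f hf => ?_
  rw [Nat.subtype_card (U.filter fun t => ∏ i, t i = f), mul_comm, ← nsmul_eq_mul,
    ← Finset.sum_const]
  · exact Finset.sum_congr rfl fun t ht => by rw [(Finset.mem_filter.1 ht).2]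
  · intro t
    rw [Finset.mem_filter, hU]
    refine ⟨fun h => ⟨h.1.1, h.2⟩, fun h => ⟨⟨h.1, ?_⟩, h.2⟩⟩
    rw [← natDegree_prod_of_monic _ _ fun i _ => h.1 i, h.2]
    exact (mem_monicsOfDegree.1 hf).2

end FiniteFieldPolynomials

theorem reflect_pow {R : Type*} [CommSemiring R] {p : R[X]} {N : ℕ} (hp : p.natDegree ≤ N)
    (k : ℕ) : reflect (k * N) (p ^ k) = reflect N p ^ k := by
  induction k with
  | zero => simp
  | succ k ih =>
    rw [add_mul, one_mul, pow_succ, reflect_mul _ _ (natDegree_pow_le_of_le k hp) hp, ih, pow_succ]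

theorem eval_one_of_reflect_eq {R : Type*} [CommSemiring R] {p : R[X]} {n : ℕ}
    (hp : p.natDegree ≤ 2 * n) (h : reflect (2 * n) p = p) :
    p.eval 1 = ∑ m ∈ Finset.range (n + 1), p.coeff m + ∑ m ∈ Finset.range n, p.coeff m := by
  rw [eval_eq_sum_range' (Nat.lt_succ_of_le hp)]
  simp only [one_pow, mul_one]
  rw [show (2 * n).succ = n + 1 + n by omega, Finset.sum_range_add]
  congr 1
  rw [← Finset.sum_range_reflect]
  refine Finset.sum_congr rfl fun m hm => ?_
  rw [Finset.mem_range] at hm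
  conv_lhs => rw [← h]
  rw [coeff_reflect, revAt_le (by omega)]
  congr 1
  omega

theorem eval_one_pow_of_reflect_eq {R : Type*} [CommSemiring R] {p : R[X]} {g : ℕ}
    (hp : p.natDegree ≤ 2 * g) (h : reflect (2 * g) p = p) (k : ℕ) :
    p.eval 1 ^ k = ∑ m ∈ Finset.range (k * g + 1), (p ^ k).coeff m +
      ∑ m ∈ Finset.range (k * g), (p ^ k).coeff m := by
  rw [← eval_pow]
  have hmul : 2 * (k * g) = k * (2 * g) := by ring
  refine eval_one_of_reflect_eq ?_ ?_
  · rw [hmul]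
    exact natDegree_pow_le_of_le k hp
  · rw [hmul, reflect_pow hp, h]

/-! ### Translation to the enumerated sums -/

section Translation

variable (q : ℕ) [Fact q.Prime]

theorem sumMn_natCast (n : ℕ) (H : Fqx q → ℂ) :
    sumMn q n H = ∑ f ∈ monicsOfDegree (ZMod q) n, H f := by
  classical
  have h0 : (0 : ℤ) ≤ n := by positivity
  rw [sumMn, if_pos h0, sum_monicsOfDegree, Int.toNat_natCast]
  have hdeg (c : Fin n → ZMod q) :
      (∑ i : Fin n, C (c i) * X ^ (i : ℕ)).degree < (n : WithBot ℕ) := by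
    rw [degree_lt_iff_coeff_zero]
    intro m hm
    simp only [finsetSum_coeff, coeff_C_mul_X_pow]
    exact Finset.sum_eq_zero fun i _ => if_neg (by omega)
  refine Finset.sum_nbij' (fun c => ∑ i : Fin n, C (c i) * X ^ (i : ℕ)) (fun b i => b.coeff i)
    ?_ ?_ ?_ ?_ ?_
  · intro c _
    exact mem_polysDegreeLT.2 (hdeg c)
  · intro b _
    exact Finset.mem_univ _
  · intro c _
    funext i
    simp [finsetSum_coeff, coeff_X_pow, Fin.val_inj]
  · intro b hb
    rw [mem_polysDegreeLT, degree_lt_iff_coeff_zero] at hb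
    ext m
    simp only [finsetSum_coeff, coeff_C_mul_X_pow]
    by_cases hm : m < n
    · rw [Finset.sum_eq_single ⟨m, hm⟩]
      · simp
      · intro i _ hi
        exact if_neg fun h => hi (Fin.ext h.symm)
      · simp
    · rw [hb m (not_lt.1 hm)]
      exact Finset.sum_eq_zero fun i _ => if_neg (by omega)
  · intro c _
    rfl

theorem legSym_eq_resChar (hq : ringChar (ZMod q) ≠ 2) (D : Fqx q) {P : Fqx q}
    (hP : Irreducible P) : legSym q D P = resChar (normalize P) D := by
  classical
  have hdvd (f : Fqx q) : P ∣ f ↔ normalize P ∣ f := (normalize_dvd_iff).symm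
  have hirr : Irreducible (normalize P) := (normalize_associated P).symm.irreducible hP
  have hmon : (normalize P).Monic := monic_normalize hP.ne_zero
  rw [legSym]
  simp only [hdvd]
  generalize normalize P = Q at hirr hmon
  have : Fact (Irreducible Q) := ⟨hirr⟩
  have : FiniteDimensional (ZMod q) (AdjoinRoot Q) := (AdjoinRoot.powerBasis hmon.ne_zero).finite
  have : Finite (AdjoinRoot Q) := Module.finite_of_finite (ZMod q)
  let _ : Fintype (AdjoinRoot Q) := Fintype.ofFinite _
  rw [resChar_eq_quadraticChar hq hmon, quadraticChar_apply, quadraticCharFun]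
  have hsq : (∃ f, Q ∣ f ^ 2 - D) ↔ IsSquare (AdjoinRoot.mk Q D) := by
    simp only [← AdjoinRoot.mk_eq_mk, map_pow]
    constructor
    · rintro ⟨f, hf⟩
      exact ⟨AdjoinRoot.mk Q f, by rw [← hf, sq]⟩
    · rintro ⟨x, hx⟩
      obtain ⟨f, rfl⟩ := AdjoinRoot.mk_surjective x
      exact ⟨f, by rw [hx, sq]⟩
  rw [if_congr hsq rfl rfl]
  simp only [← AdjoinRoot.mk_eq_zero]

theorem jacSym_eq_resChar (hq : ringChar (ZMod q) ≠ 2) (D : Fqx q) {f : Fqx q} (hf : f.Monic) :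
    jacSym q D f = resChar f D := by
  have key (s : Multiset (Fqx q)) (hs : ∀ P ∈ s, Irreducible P) :
      (s.map fun P => legSym q D P).prod = resChar (normalize s.prod) D := by
    induction s using Multiset.induction_on with
    | empty => simp [resChar_one_left]
    | cons P s ih =>
      have hP := hs P (Multiset.mem_cons_self P s)
      have hs' : ∀ P ∈ s, Irreducible P := fun R hR => hs R (Multiset.mem_cons_of_mem hR)
      have h0 : s.prod ≠ 0 := Multiset.prod_ne_zero fun h => (hs' 0 h).ne_zero rfl
      rw [Multiset.map_cons, Multiset.prod_cons, Multiset.prod_cons, normalize_mul,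
        resChar_mul_left (monic_normalize hP.ne_zero) (monic_normalize h0),
        legSym_eq_resChar q hq D hP, ih hs']
  rw [jacSym, if_neg hf.ne_zero, key _ fun P hP =>
    UniqueFactorizationMonoid.irreducible_of_factor P hP,
    normalize_eq_normalize_iff_associated.2 (UniqueFactorizationMonoid.factors_prod hf.ne_zero),
    hf.normalize_eq_self]

end Translation

theorem sqrt_natCast_pow (q n : ℕ) :
    (Real.sqrt ((q : ℝ) ^ n) : ℂ) = (Real.sqrt q : ℂ) ^ n := by
  rw [← Complex.ofReal_pow, Complex.ofReal_inj, Real.sqrt_eq_iff_mul_self_eq (by positivity)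
    (by positivity), ← mul_pow, Real.mul_self_sqrt q.cast_nonneg]

/-- the exact ("approximate") functional equation: for `D ∈ H_{2g+1}`,
`L(1/2,χ_D)^k = ∑_{f ∈ M_{≤kg}} χ_D(f) d_k(f)/√|f| + ∑_{f ∈ M_{≤kg-1}} χ_D(f) d_k(f)/√|f|`. -/
theorem functional_equation_Lhalf_pow (q : ℕ) [Fact q.Prime] (hq4 : q % 4 = 1)
    (g : ℕ) (D : Fqx q) (hD : D.Monic) (hDsf : Squarefree D)
    (hdeg : D.natDegree = 2 * g + 1) (k : ℕ) (hk : 0 < k) :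
    Lhalf q D ^ k =
      sumMle q ((k * g : ℕ) : ℤ) (fun f =>
        chi q D f * (dk q k f : ℂ) / (Real.sqrt ((q : ℝ) ^ f.natDegree) : ℂ)) +
      sumMle q (((k * g : ℕ) : ℤ) - 1) (fun f =>
        chi q D f * (dk q k f : ℂ) / (Real.sqrt ((q : ℝ) ^ f.natDegree) : ℂ)) := by
  have hF : ringChar (ZMod q) ≠ 2 := by
    rw [ZMod.ringChar_zmod_n]
    rintro rfl
    omega
  have hneg : quadraticChar (ZMod q) (-1) = 1 := by
    rw [quadraticChar_one_iff_isSquare (by simp), FiniteField.isSquare_neg_one_iff, ZMod.card]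
    omega
  have he := ZMod.isPrimitive_stdAddChar q
  set r : ℂ := (Real.sqrt q : ℂ) with hr
  have hrr : r ^ 2 = q := by
    rw [hr, ← Complex.ofReal_pow, Real.sq_sqrt q.cast_nonneg, Complex.ofReal_natCast]
  have hr0 : r ≠ 0 := by
    rintro h0
    rw [h0, zero_pow two_ne_zero] at hrr
    exact (Fact.out : q.Prime).ne_zero (by exact_mod_cast hrr.symm)
  have hchi {f : Fqx q} (hf : f.Monic) : chi q D f = resChar D f := by
    rw [chi, jacSym_eq_resChar q hF D hf, resChar_comm hneg]
  let χ (f : Fqx q) : ℂ := resChar D f * (r ^ f.natDegree)⁻¹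
  have hsum (n : ℕ) : ∑ f ∈ monicsOfDegree (ZMod q) n, χ f =
      (∑ f ∈ monicsOfDegree (ZMod q) n, (resChar D f : ℂ)) * (r ^ n)⁻¹ := by
    rw [Finset.sum_mul]
    exact Finset.sum_congr rfl fun f hf => by rw [← (mem_monicsOfDegree.1 hf).2]
  let p : ℂ[X] := ∑ n ∈ Finset.range (2 * g + 1),
    monomial n (∑ f ∈ monicsOfDegree (ZMod q) n, χ f)
  have hp (n : ℕ) : p.coeff n = ∑ f ∈ monicsOfDegree (ZMod q) n, χ f := by
    simp only [p, finsetSum_coeff, coeff_monomial, Finset.sum_ite_eq', Finset.mem_range]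
    split_ifs with hn
    · rfl
    · have := sum_monicsOfDegree_resChar_eq_zero _ hF hneg he hD hDsf (by omega) (n := n) (by omega)
      rw [hsum, show ∑ f ∈ monicsOfDegree (ZMod q) n, (resChar D f : ℂ) = 0 by exact_mod_cast this,
        zero_mul]
  have hpdeg : p.natDegree ≤ 2 * g :=
    natDegree_sum_le_of_forall_le _ _ fun n hn =>
      (natDegree_monomial_le _).trans (Nat.lt_succ_iff.1 (Finset.mem_range.1 hn))
  have hrefl : reflect (2 * g) p = p := by
    ext n
    rw [coeff_reflect]
    rcases le_or_gt n (2 * g) with hn | hn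
    · obtain ⟨m, hm⟩ := Nat.exists_eq_add_of_le hn
      rw [revAt_le hn, show 2 * g - n = m by omega, hp, hp, hsum, hsum]
      have hfe := sum_monicsOfDegree_resChar_reflect _ hF hneg he hD hDsf hdeg hm.symm
      rw [ZMod.card, ← hrr, ← pow_mul, ← pow_mul, hm, two_mul, pow_add, pow_add] at hfe
      have hn0 := pow_ne_zero n hr0
      have hm0 := pow_ne_zero m hr0
      field_simp
      exact mul_left_cancel₀ hn0 (by linear_combination -hfe)
    · rw [revAt_eq_self_of_lt hn]
  have hcoeff (m : ℕ) : (p ^ k).coeff m = sumMn q m fun f =>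
      chi q D f * (dk q k f : ℂ) / (Real.sqrt ((q : ℝ) ^ f.natDegree) : ℂ) := by
    rw [coeff_pow_eq_sum_monicsOfDegree p χ hp k, sumMn_natCast]
    · refine Finset.sum_congr rfl fun f hf => ?_
      rw [hchi (mem_monicsOfDegree.1 hf).1, sqrt_natCast_pow, div_eq_mul_inv]
      exact mul_right_comm _ _ _
    · intro t ht
      simp only [χ]
      rw [resChar_prod_right hD, natDegree_prod_of_monic _ _ fun i _ => ht i,
        ← Finset.prod_pow_eq_pow_sum, Int.cast_prod, ← Finset.prod_inv_distrib,
        Finset.prod_mul_distrib]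
  have hL : Lhalf q D = p.eval 1 := by
    rw [eval_eq_sum_range' (Nat.lt_succ_of_le hpdeg), Lhalf, hdeg]
    refine Finset.sum_congr rfl fun n _ => ?_
    rw [one_pow, mul_one, hp, hsum, sumMn_natCast, sqrt_natCast_pow, div_eq_mul_inv]
    congr 1
    exact Finset.sum_congr rfl fun f hf => hchi (mem_monicsOfDegree.1 hf).1
  rw [hL, eval_one_pow_of_reflect_eq hpdeg hrefl, sumMle, sumMle, sub_add_cancel,
    Int.toNat_natCast, show ((k * g : ℕ) + 1 : ℤ).toNat = k * g + 1 by omega]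
  simp only [hcoeff]
end

section
/- In F_q[x], for |u| < 1/q one has the identity Σ_{l ∈ M} ( d_2(l^2) / ∏_{P | l} (1 + |P|^{−1}) ) u^{d(l)} = ((1 − qu^2)/(1 − qu)^3) · B(u), where B(u) = ∏_P ( 1 + u^{d(P)}(u^{d(P)} − 3)/((|P|+1)(1 + u^{d(P)})) ); moreover the Euler product B(u) converges absolutely for |u| < 1. -/
/- Setting: `F_q[x]` with `q` prime, `q ≡ 1 (mod 4)`.  `M_n` denotes the monic
polynomials of degree `n`, `M_{≤n}` those of degree at most `n`, `H_n` the monic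
squarefree polynomials of degree `n`. -/

open Polynomial

noncomputable section

attribute [local instance] Classical.propDecidable

end

/-- Finitely supported functions supported in `insert a S` split off their value at `a`. -/
noncomputable def Finsupp.supportInsertEquiv {ι : Type*} [DecidableEq ι]
    {a : ι} {S : Finset ι} (ha : a ∉ S) :
    {n : ι →₀ ℕ // n.support ⊆ insert a S} ≃ ℕ × {n : ι →₀ ℕ // n.support ⊆ S} where
  toFun n := (n.1 a, ⟨n.1.erase a, by
    rw [Finsupp.support_erase, ← Finset.subset_insert_iff]; exact n.2⟩)
  invFun p := ⟨p.2.1.update a p.1, Finset.Subset.trans (Finsupp.support_update_subset _ _)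
    (Finset.insert_subset_insert a p.2.2)⟩
  left_inv n := by
    ext i
    by_cases h : i = a <;> simp [h]
  right_inv p := by
    have h0 : p.2.1 a = 0 := Finsupp.notMem_support_iff.mp fun h => ha (p.2.2 h)
    ext i
    · simp
    · by_cases h : i = a <;> simp [h, h0]

theorem summable_and_hasSum_prod_of_support_subset {ι 𝕜 : Type*} [NormedField 𝕜]
    [CompleteSpace 𝕜] {g : ι → ℕ → 𝕜} (hg0 : ∀ i, g i 0 = 1) (hg : ∀ i, Summable (‖g i ·‖))
    (S : Finset ι) :
    Summable (fun n : {n : ι →₀ ℕ // n.support ⊆ S} => ‖n.1.prod g‖) ∧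
      HasSum (fun n : {n : ι →₀ ℕ // n.support ⊆ S} => n.1.prod g) (∏ i ∈ S, ∑' k, g i k) := by
  classical
  induction S using Finset.induction_on with
  | empty =>
    have : Unique {n : ι →₀ ℕ // n.support ⊆ ∅} :=
      ⟨⟨⟨0, by simp⟩⟩, fun n => Subtype.ext (by simpa using n.2)⟩
    refine ⟨(hasSum_unique _).summable, ?_⟩
    convert hasSum_unique (fun n : {n : ι →₀ ℕ // n.support ⊆ ∅} => n.1.prod g)
    have : (default : {n : ι →₀ ℕ // n.support ⊆ ∅}).1 = 0 := by
      simpa using (default : {n : ι →₀ ℕ // n.support ⊆ ∅}).2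
    simp [this]
  | insert a S ha ih =>
    have key : (fun n : {n : ι →₀ ℕ // n.support ⊆ insert a S} => n.1.prod g) =
        (fun p : ℕ × {n : ι →₀ ℕ // n.support ⊆ S} => g a p.1 * p.2.1.prod g) ∘
          Finsupp.supportInsertEquiv ha := by
      ext n
      exact (Finsupp.mul_prod_erase' n.1 a g hg0).symm
    have hs := (hg a).mul_norm ih.1
    rw [Finset.prod_insert ha]
    have hs' := (Finsupp.supportInsertEquiv ha).hasSum_iff.mpr
      ((hg a).of_norm.hasSum.mul ih.2 hs.of_norm)
    rw [← key] at hs'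
    refine ⟨((Finsupp.supportInsertEquiv ha).summable_iff.mpr hs).congr fun n => ?_, hs'⟩
    exact congrArg norm (congrFun key n).symm

theorem summable_norm_finsupp_prod {ι 𝕜 : Type*} [NormedField 𝕜]
    {g : ι → ℕ → 𝕜} (hg0 : ∀ i, g i 0 = 1) (hg : ∀ i, Summable (‖g i ·‖))
    (hs : Summable fun i => ∑' k, ‖g i (k + 1)‖) :
    Summable fun n : ι →₀ ℕ => ‖n.prod g‖ := by
  classical
  have hb (i) : 0 ≤ ∑' k, ‖g i (k + 1)‖ := tsum_nonneg fun _ => norm_nonneg _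
  refine summable_of_sum_le (c := Real.exp (∑' i, ∑' k, ‖g i (k + 1)‖))
    (fun _ => norm_nonneg _) fun T => ?_
  set S := T.biUnion Finsupp.support with hS
  have hnorm (n : ι →₀ ℕ) : ‖n.prod g‖ = n.prod fun i k => ‖g i k‖ := by
    simp [Finsupp.prod, norm_prod]
  obtain ⟨h1, h2⟩ := summable_and_hasSum_prod_of_support_subset (𝕜 := ℝ)
    (g := fun i k => ‖g i k‖) (by simp [hg0]) (by simpa using hg) S
  have hT : ∀ n ∈ T, n.support ⊆ S := fun n hn => Finset.subset_biUnion_of_mem _ hn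
  calc ∑ n ∈ T, ‖n.prod g‖
      = ∑ n ∈ T.subtype fun n => n.support ⊆ S, n.1.prod fun i k => ‖g i k‖ := by
        rw [Finset.sum_subtype_of_mem (fun n => n.prod fun i k => ‖g i k‖) hT]
        simp [hnorm]
    _ ≤ ∏ i ∈ S, ∑' k, ‖g i k‖ :=
        sum_le_hasSum _ (fun n _ => hnorm n.1 ▸ norm_nonneg _) h2
    _ = ∏ i ∈ S, (1 + ∑' k, ‖g i (k + 1)‖) := by
        refine Finset.prod_congr rfl fun i _ => ?_
        rw [(hg i).tsum_eq_zero_add, hg0, norm_one]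
    _ ≤ Real.exp (∑ i ∈ S, ∑' k, ‖g i (k + 1)‖) := Real.prod_one_add_le_exp_sum _ hb
    _ ≤ _ := Real.exp_le_exp.mpr (hs.sum_le_tsum _ fun i _ => hb i)

/-- An Euler product over an arbitrary index set. -/
theorem hasProd_tsum_of_finsupp_prod {ι 𝕜 : Type*} [NormedField 𝕜] [CompleteSpace 𝕜]
    {g : ι → ℕ → 𝕜} (hg0 : ∀ i, g i 0 = 1) (hg : ∀ i, Summable (‖g i ·‖))
    (hs : Summable fun n : ι →₀ ℕ => ‖n.prod g‖) :
    HasProd (fun i => ∑' k, g i k) (∑' n : ι →₀ ℕ, n.prod g) := by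
  classical
  have h (S : Finset ι) : ∏ i ∈ S, ∑' k, g i k =
      ∑' n, Set.indicator {n : ι →₀ ℕ | n.support ⊆ S} (fun n => n.prod g) n := by
    rw [← tsum_subtype]
    exact (summable_and_hasSum_prod_of_support_subset hg0 hg S).2.tsum_eq.symm
  unfold HasProd
  simp_rw [h]
  refine tendsto_tsum_of_dominated_convergence hs (fun n => ?_)
    (.of_forall fun S n => norm_indicator_le_norm_self _ _)
  refine tendsto_const_nhds.congr' ?_
  filter_upwards [Filter.eventually_ge_atTop n.support] with S hS
  rw [Set.indicator_of_mem]
  exact hS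

section MonicFactorization

variable {F : Type*} [Field F]

/-- The monic polynomial with prescribed multiplicities of its monic irreducible factors. -/
noncomputable def monicFinsuppProd (n : {P : F[X] // P.Monic ∧ Irreducible P} →₀ ℕ) : F[X] :=
  n.prod fun P k => P.1 ^ k

theorem monic_monicFinsuppProd (n : {P : F[X] // P.Monic ∧ Irreducible P} →₀ ℕ) :
    (monicFinsuppProd n).Monic :=
  monic_prod_of_monic _ _ fun P _ => P.2.1.pow _

theorem monicFinsuppProd_add (m n : {P : F[X] // P.Monic ∧ Irreducible P} →₀ ℕ) :
    monicFinsuppProd (m + n) = monicFinsuppProd m * monicFinsuppProd n :=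
  Finsupp.prod_add_index' (fun _ => pow_zero _) fun _ _ _ => pow_add _ _ _

theorem prod_map_val_toMultiset (n : {P : F[X] // P.Monic ∧ Irreducible P} →₀ ℕ) :
    (n.toMultiset.map Subtype.val).prod = monicFinsuppProd n := by
  rw [Finsupp.toMultiset_map, Finsupp.prod_toMultiset,
    Finsupp.prod_mapDomain_index (fun _ => pow_zero _) fun _ _ _ => pow_add _ _ _]
  rfl

theorem monicFinsuppProd_injective :
    Function.Injective (monicFinsuppProd (F := F)) := by
  intro m n h
  rw [← prod_map_val_toMultiset, ← prod_map_val_toMultiset] at h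
  have hirr (n : {P : F[X] // P.Monic ∧ Irreducible P} →₀ ℕ) :
      ∀ x ∈ n.toMultiset.map Subtype.val, Irreducible x := by
    intro x hx
    obtain ⟨P, -, rfl⟩ := Multiset.mem_map.mp hx
    exact P.2.2
  have hrel := UniqueFactorizationMonoid.factors_unique (hirr m) (hirr n) (.of_eq h)
  rw [Multiset.rel_map] at hrel
  have := hrel.mono fun a _ b _ hab =>
    Subtype.ext (eq_of_monic_of_associated a.2.1 b.2.1 hab)
  rw [Multiset.rel_eq] at this
  classical simpa using congrArg Multiset.toFinsupp this

theorem exists_monicFinsuppProd_eq {f : F[X]} (hf : f.Monic) :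
    ∃ n, monicFinsuppProd n = f := by
  classical
  have hmem : ∀ P ∈ UniqueFactorizationMonoid.normalizedFactors f, P.Monic ∧ Irreducible P := by
    intro P hP
    have hirr := UniqueFactorizationMonoid.irreducible_of_normalized_factor P hP
    refine ⟨?_, hirr⟩
    rw [← UniqueFactorizationMonoid.normalize_normalized_factor P hP]
    exact monic_normalize hirr.ne_zero
  obtain ⟨s, hs⟩ : ∃ s : Multiset {P : F[X] // P.Monic ∧ Irreducible P},
      s.map Subtype.val = UniqueFactorizationMonoid.normalizedFactors f :=
    ⟨Multiset.pmap Subtype.mk _ hmem, by simp [Multiset.map_pmap, Multiset.pmap_eq_map]⟩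
  refine ⟨Multiset.toFinsupp s, ?_⟩
  rw [← prod_map_val_toMultiset, Multiset.toFinsupp_toMultiset, hs,
    UniqueFactorizationMonoid.prod_normalizedFactors_eq hf.ne_zero, hf.normalize_eq_self]

/-- Unique factorization: monic polynomials correspond to finitely supported multiplicity
functions on the monic irreducible polynomials. -/
noncomputable def monicFinsuppEquiv :
    ({P : F[X] // P.Monic ∧ Irreducible P} →₀ ℕ) ≃ {f : F[X] // f.Monic} :=
  Equiv.ofBijective (fun n => ⟨monicFinsuppProd n, monic_monicFinsuppProd n⟩)
    ⟨fun _ _ h => monicFinsuppProd_injective (congrArg Subtype.val h),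
      fun f => (exists_monicFinsuppProd_eq f.2).imp fun _ h => Subtype.ext h⟩

@[simp]
theorem coe_monicFinsuppEquiv (n : {P : F[X] // P.Monic ∧ Irreducible P} →₀ ℕ) :
    (monicFinsuppEquiv n : F[X]) = monicFinsuppProd n :=
  rfl

theorem pow_natDegree_monicFinsuppProd {M : Type*} [CommMonoid M] (u : M)
    (n : {P : F[X] // P.Monic ∧ Irreducible P} →₀ ℕ) :
    u ^ (monicFinsuppProd n).natDegree = n.prod fun P k => (u ^ P.1.natDegree) ^ k := by
  rw [monicFinsuppProd, Finsupp.prod, natDegree_prod_of_monic _ _ fun P _ => P.2.1.pow _,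
    ← Finset.prod_pow_eq_pow_sum, Finsupp.prod]
  exact Finset.prod_congr rfl fun P _ => by rw [P.2.1.natDegree_pow, mul_comm, pow_mul]

theorem dvd_monicFinsuppProd_iff (n : {P : F[X] // P.Monic ∧ Irreducible P} →₀ ℕ)
    (P : {P : F[X] // P.Monic ∧ Irreducible P}) :
    P.1 ∣ monicFinsuppProd n ↔ P ∈ n.support := by
  constructor
  · intro h
    obtain ⟨Q, hQ, hPQ⟩ := (P.2.2.prime.dvd_finsetProd_iff _).mp h
    have := P.2.2.associated_of_dvd Q.2.2 (P.2.2.prime.dvd_of_dvd_pow hPQ)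
    rwa [Subtype.ext (eq_of_monic_of_associated P.2.1 Q.2.1 this)]
  · intro h
    exact (dvd_pow_self P.1 (Finsupp.mem_support_iff.mp h)).trans
      (Finset.dvd_prod_of_mem (fun P => P.1 ^ n P) h)

theorem tprod_monic_irreducible_dvd (n : {P : F[X] // P.Monic ∧ Irreducible P} →₀ ℕ)
    {R : Type*} [CommMonoid R] [TopologicalSpace R] (f : F[X] → R) :
    ∏' P : {P : F[X] // P.Monic ∧ Irreducible P ∧ P ∣ monicFinsuppProd n}, f P.1 =
      ∏ P ∈ n.support, f P.1 := by
  let e : {P : F[X] // P.Monic ∧ Irreducible P ∧ P ∣ monicFinsuppProd n} ≃ n.support :=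
    { toFun P := ⟨⟨P.1, P.2.1, P.2.2.1⟩,
        (dvd_monicFinsuppProd_iff n ⟨P.1, P.2.1, P.2.2.1⟩).mp P.2.2.2⟩
      invFun P := ⟨P.1.1, P.1.2.1, P.1.2.2, (dvd_monicFinsuppProd_iff n P.1).mpr P.2⟩
      left_inv _ := rfl
      right_inv _ := rfl }
  rw [← Finset.tprod_subtype, ← e.tprod_eq]
  rfl

end MonicFactorization

theorem dk_two_monicFinsuppProd (q : ℕ) [Fact q.Prime] (n : MIrr q →₀ ℕ) :
    dk q 2 (monicFinsuppProd n) = n.prod fun _ k => k + 1 := by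
  classical
  have hbij : Function.Bijective (fun m : Finset.Iic n =>
      (⟨![monicFinsuppProd m.1, monicFinsuppProd (n - m.1)],
        Fin.forall_fin_two.mpr ⟨monic_monicFinsuppProd _, monic_monicFinsuppProd _⟩, by
          rw [Fin.prod_univ_two, Matrix.cons_val_zero, Matrix.cons_val_one, Matrix.cons_val_zero,
            ← monicFinsuppProd_add, add_tsub_cancel_of_le (Finset.mem_Iic.mp m.2)]⟩ :
        {t : Fin 2 → Fqx q // (∀ i, (t i).Monic) ∧ ∏ i, t i = monicFinsuppProd n})) := by
    constructor
    · intro m m' h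
      exact Subtype.ext (monicFinsuppProd_injective (congrFun (congrArg Subtype.val h) 0))
    · rintro ⟨t, ht, hprod⟩
      obtain ⟨a, ha⟩ := exists_monicFinsuppProd_eq (ht 0)
      obtain ⟨b, hb⟩ := exists_monicFinsuppProd_eq (ht 1)
      rw [Fin.prod_univ_two, ← ha, ← hb, ← monicFinsuppProd_add] at hprod
      obtain rfl := monicFinsuppProd_injective hprod
      refine ⟨⟨a, Finset.mem_Iic.mpr le_self_add⟩, Subtype.ext (funext fun i => ?_)⟩
      fin_cases i
      · exact ha
      · simpa using hb
  rw [dk, ← Nat.card_congr (Equiv.ofBijective _ hbij), Nat.card_eq_fintype_card,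
    Fintype.card_coe, Finsupp.card_Iic]
  simp [Finsupp.prod]

theorem dk_two_sq_monicFinsuppProd (q : ℕ) [Fact q.Prime] (n : MIrr q →₀ ℕ) :
    dk q 2 (monicFinsuppProd n ^ 2) = n.prod fun _ k => 2 * k + 1 := by
  rw [sq, ← monicFinsuppProd_add, dk_two_monicFinsuppProd, Finsupp.prod_of_support_subset (n + n)
    (s := n.support) (fun P => by simp) _ (by simp)]
  exact Finset.prod_congr rfl fun P _ => by simp [two_mul]

theorem summable_odd_mul_geometric {r : ℝ} (hr0 : 0 ≤ r) (hr : r < 1) :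
    Summable fun k : ℕ => (2 * k + 1 : ℝ) * r ^ k := by
  have hr' : ‖r‖ < 1 := by rwa [Real.norm_of_nonneg hr0]
  have h1 := (hasSum_coe_mul_geometric_of_norm_lt_one hr').summable
  have h2 := summable_geometric_of_lt_one hr0 hr
  exact ((h1.mul_left 2).add h2).congr fun k => by ring

theorem hasSum_odd_mul_geometric {x : ℂ} (hx : ‖x‖ < 1) :
    HasSum (fun k : ℕ => (2 * k + 1 : ℂ) * x ^ k) ((1 + x) / (1 - x) ^ 2) := by
  have hx1 : 1 - x ≠ 0 := sub_ne_zero.mpr fun h => by simp [← h] at hx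
  rw [show (1 + x) / (1 - x) ^ 2 = 2 * (x / (1 - x) ^ 2) + (1 - x)⁻¹ by field_simp; ring]
  simpa only [add_mul, one_mul, mul_assoc] using
    ((hasSum_coe_mul_geometric_of_norm_lt_one hx).mul_left 2).add
      (hasSum_geometric_of_norm_lt_one hx)

theorem one_le_norm_one_add_inv_nm (q : ℕ) (P : Fqx q) : 1 ≤ ‖1 + 1 / nm q P‖ := by
  have h : (1 + 1 / nm q P : ℂ) = ((1 + 1 / q ^ P.natDegree : ℝ) : ℂ) := by simp [nm]
  have : (0 : ℝ) ≤ 1 / q ^ P.natDegree := by positivity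
  rw [h, Complex.norm_real, Real.norm_of_nonneg (by linarith)]
  linarith

/-- The coefficients of the local factor at `P` of `∑ d₂(l²) / ∏_{P ∣ l} (1 + |P|⁻¹) u^(deg l)`. -/
noncomputable def localTerm (q : ℕ) (u : ℂ) (P : MIrr q) (k : ℕ) : ℂ :=
  if k = 0 then 1 else (2 * k + 1) / (1 + 1 / nm q P.1) * (u ^ P.1.natDegree) ^ k

theorem norm_localTerm_le (q : ℕ) (u : ℂ) (P : MIrr q) (k : ℕ) :
    ‖localTerm q u P k‖ ≤ (2 * k + 1) * ‖u ^ P.1.natDegree‖ ^ k := by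
  unfold localTerm
  split_ifs with hk
  · simp [hk]
  · rw [norm_mul, norm_div, norm_pow _ k]
    have h : ‖(2 * k + 1 : ℂ)‖ = 2 * k + 1 := by
      exact_mod_cast Complex.norm_natCast (2 * k + 1)
    rw [h]
    gcongr
    exact div_le_self (by positivity) (one_le_norm_one_add_inv_nm q P.1)

section EulerProduct

variable (q : ℕ) [Fact q.Prime]

theorem card_monic_natDegree_eq (n : ℕ) :
    Nat.card {f : Fqx q // f.Monic ∧ f.natDegree = n} = q ^ n := by
  rw [Nat.card_congr ((monicEquivDegreeLT n).trans (degreeLTEquiv (ZMod q) n).toEquiv)]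
  simp

theorem hasSum_monic_natDegree_eq {𝕜 : Type*} [NormedField 𝕜] (u : 𝕜) (n : ℕ) :
    HasSum (fun f : {f : Fqx q // f.Monic ∧ f.natDegree = n} => u ^ f.1.natDegree)
      ((q * u) ^ n) := by
  have : Finite {f : Fqx q // f.Monic ∧ f.natDegree = n} :=
    Nat.finite_of_card_ne_zero (by
      rw [card_monic_natDegree_eq]; exact pow_ne_zero _ (Fact.out : q.Prime).ne_zero)
  have := Fintype.ofFinite {f : Fqx q // f.Monic ∧ f.natDegree = n}
  convert hasSum_fintype _
  rw [Finset.sum_congr rfl fun f _ => by rw [f.2.2], Finset.sum_const, Finset.card_univ,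
    ← Nat.card_eq_fintype_card, card_monic_natDegree_eq, nsmul_eq_mul, mul_pow, Nat.cast_pow]

/-- The zeta function of `F_q[x]`. -/
theorem hasSum_monic_pow_natDegree {𝕜 : Type*} [RCLike 𝕜] {u : 𝕜} (hu : ‖u‖ < 1 / q) :
    HasSum (fun f : {f : Fqx q // f.Monic} => u ^ f.1.natDegree) (1 - q * u)⁻¹ := by
  have hq : (0 : ℝ) < q := mod_cast (Fact.out : q.Prime).pos
  have hqu : q * ‖u‖ < 1 := by rwa [lt_div_iff₀ hq, mul_comm] at hu
  let e : (Σ n, {f : Fqx q // f.Monic ∧ f.natDegree = n}) ≃ {f : Fqx q // f.Monic} :=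
    { toFun p := ⟨p.2.1, p.2.2.1⟩
      invFun f := ⟨_, f.1, f.2, rfl⟩
      left_inv := by rintro ⟨_, f, hf, rfl⟩; rfl
      right_inv _ := rfl }
  have hsum : Summable fun p : Σ n, {f : Fqx q // f.Monic ∧ f.natDegree = n} =>
      ‖u‖ ^ p.2.1.natDegree := by
    rw [summable_sigma_of_nonneg fun _ => by positivity]
    refine ⟨fun n => (hasSum_monic_natDegree_eq q ‖u‖ n).summable, ?_⟩
    simp_rw [(hasSum_monic_natDegree_eq q ‖u‖ _).tsum_eq]
    exact summable_geometric_of_lt_one (by positivity) hqu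
  have hsum' : Summable fun p : Σ n, {f : Fqx q // f.Monic ∧ f.natDegree = n} =>
      u ^ p.2.1.natDegree := .of_norm (by simpa using hsum)
  rw [← e.hasSum_iff]
  exact HasSum.of_sigma (fun n => hasSum_monic_natDegree_eq q u n)
    (hasSum_geometric_of_norm_lt_one (by simpa using hqu)) hsum'.hasSum.cauchySeq

theorem summable_irreducible_pow_natDegree {r : ℝ} (hr0 : 0 ≤ r) (hr : r < 1 / q) :
    Summable fun P : MIrr q => r ^ P.1.natDegree := by
  have h := (hasSum_monic_pow_natDegree q (u := r) (by rwa [Real.norm_of_nonneg hr0])).summable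
  exact h.comp_injective (i := fun P : MIrr q => (⟨P.1, P.2.1⟩ : {f : Fqx q // f.Monic}))
    fun P Q h => Subtype.ext (congrArg (fun f => f.1) h)

theorem norm_pow_natDegree_le {u : ℂ} (hu : ‖u‖ < 1) (P : MIrr q) :
    ‖u ^ P.1.natDegree‖ ≤ ‖u‖ := by
  rw [norm_pow]
  exact pow_le_of_le_one (norm_nonneg _) hu.le P.2.2.natDegree_pos.ne'

/-- Euler products over the monic irreducible polynomials. -/
theorem hasSum_hasProd_of_norm_le {u : ℂ} (hu : ‖u‖ < 1 / q) {g : MIrr q → ℕ → ℂ}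
    (hg0 : ∀ P, g P 0 = 1)
    (hg : ∀ P k, ‖g P k‖ ≤ (2 * k + 1) * ‖u ^ P.1.natDegree‖ ^ k) :
    Summable (fun n : MIrr q →₀ ℕ => n.prod g) ∧
      HasProd (fun P => ∑' k, g P k) (∑' n : MIrr q →₀ ℕ, n.prod g) := by
  have hq : (1 : ℝ) ≤ q := mod_cast (Fact.out : q.Prime).one_le
  have hu1 : ‖u‖ < 1 := hu.trans_le (by rw [div_le_one (by positivity)]; exact hq)
  have hgs (P : MIrr q) : Summable (‖g P ·‖) :=
    (summable_odd_mul_geometric (norm_nonneg _)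
      ((norm_pow_natDegree_le q hu1 P).trans_lt hu1)).of_nonneg_of_le
      (fun _ => norm_nonneg _) (hg P)
  have hC : Summable fun k : ℕ => (2 * k + 3 : ℝ) * ‖u‖ ^ k :=
    ((summable_odd_mul_geometric (norm_nonneg u) hu1).add
      ((summable_geometric_of_lt_one (norm_nonneg u) hu1).mul_left 2)).congr fun k => by ring
  have hs : Summable fun P : MIrr q => ∑' k, ‖g P (k + 1)‖ := by
    refine ((summable_irreducible_pow_natDegree q (norm_nonneg u) hu).mul_right
      (∑' k : ℕ, (2 * k + 3 : ℝ) * ‖u‖ ^ k)).of_nonneg_of_le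
      (fun P => tsum_nonneg fun _ => norm_nonneg _) fun P => ?_
    rw [← tsum_mul_left]
    refine ((summable_nat_add_iff 1).mpr (hgs P)).tsum_le_tsum (fun k => ?_) (hC.mul_left _)
    calc ‖g P (k + 1)‖ ≤ (2 * (k + 1 : ℕ) + 1) * ‖u ^ P.1.natDegree‖ ^ (k + 1) := hg P (k + 1)
      _ = ‖u‖ ^ P.1.natDegree * ((2 * k + 3) * ‖u ^ P.1.natDegree‖ ^ k) := by
        push_cast [norm_pow]; ring
      _ ≤ _ := by
        gcongr
        exact norm_pow_natDegree_le q hu1 P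
  have h := summable_norm_finsupp_prod hg0 hgs hs
  exact ⟨h.of_norm, hasProd_tsum_of_finsupp_prod hg0 hgs h⟩

/-- The Euler product of the zeta function of `F_q[x]`. -/
theorem hasProd_zeta {u : ℂ} (hu : ‖u‖ < 1 / q) :
    HasProd (fun P : MIrr q => (1 - u ^ P.1.natDegree)⁻¹) (1 - q * u)⁻¹ := by
  have hq : (1 : ℝ) ≤ q := mod_cast (Fact.out : q.Prime).one_le
  have hu1 : ‖u‖ < 1 := hu.trans_le (by rw [div_le_one (by positivity)]; exact hq)
  have h := (hasSum_hasProd_of_norm_le q hu (g := fun P k => (u ^ P.1.natDegree) ^ k)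
    (fun _ => pow_zero _) fun P k => by
      rw [norm_pow _ k]
      exact le_mul_of_one_le_left (by positivity) (by linarith [k.cast_nonneg (α := ℝ)])).2
  have hz := monicFinsuppEquiv.hasSum_iff.mpr (hasSum_monic_pow_natDegree q hu)
  simp only [← pow_natDegree_monicFinsuppProd] at h
  rw [show ∑' n : MIrr q →₀ ℕ, u ^ (monicFinsuppProd n).natDegree = _ from hz.tsum_eq] at h
  refine h.congr_fun fun P => ?_
  exact (tsum_geometric_of_norm_lt_one ((norm_pow_natDegree_le q hu1 P).trans_lt hu1)).symm

theorem summable_norm_Bfun_factor {u : ℂ} (hu : ‖u‖ < 1) :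
    Summable fun P : MIrr q => ‖u ^ P.1.natDegree * (u ^ P.1.natDegree - 3) /
      ((nm q P.1 + 1) * (1 + u ^ P.1.natDegree))‖ := by
  have hq : (0 : ℝ) < q := mod_cast (Fact.out : q.Prime).pos
  have hr : ‖u‖ / q < 1 / q := by gcongr
  refine ((summable_irreducible_pow_natDegree q (by positivity) hr).mul_right
    (4 / (1 - ‖u‖))).of_nonneg_of_le (fun _ => norm_nonneg _) fun P => ?_
  have hx := norm_pow_natDegree_le q hu P
  have hnm : (q : ℝ) ^ P.1.natDegree ≤ ‖nm q P.1 + 1‖ := by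
    rw [nm, show (q : ℂ) ^ P.1.natDegree + 1 = (q ^ P.1.natDegree + 1 : ℕ) by push_cast; rfl,
      Complex.norm_natCast]
    push_cast
    linarith
  have hnum : ‖u ^ P.1.natDegree - 3‖ ≤ 4 := by
    refine (norm_sub_le _ _).trans ?_
    rw [Complex.norm_ofNat]
    linarith
  have hden : 1 - ‖u‖ ≤ ‖1 + u ^ P.1.natDegree‖ := by
    have := norm_sub_le_norm_add (1 : ℂ) (u ^ P.1.natDegree)
    rw [norm_one] at this
    linarith
  have h1 : 0 < 1 - ‖u‖ := by linarith
  rw [norm_div, norm_mul, norm_mul, div_pow, div_mul_div_comm, norm_pow]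
  gcongr

theorem localTerm_finsupp_prod (u : ℂ) (n : MIrr q →₀ ℕ) :
    n.prod (localTerm q u) =
      (dk q 2 (monicFinsuppProd n ^ 2) : ℂ) /
        (∏' P : {P : Fqx q // P.Monic ∧ Irreducible P ∧ P ∣ monicFinsuppProd n},
          (1 + 1 / nm q P.1)) * u ^ (monicFinsuppProd n).natDegree := by
  rw [tprod_monic_irreducible_dvd n fun P => 1 + 1 / nm q P, dk_two_sq_monicFinsuppProd,
    pow_natDegree_monicFinsuppProd, Finsupp.prod, Finsupp.prod, Finsupp.prod, Nat.cast_prod,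
    ← Finset.prod_div_distrib, ← Finset.prod_mul_distrib]
  refine Finset.prod_congr rfl fun P hP => ?_
  rw [localTerm, if_neg (Finsupp.mem_support_iff.mp hP)]
  push_cast
  rfl

theorem tsum_localTerm_mul {u : ℂ} (hu : ‖u‖ < 1) (P : MIrr q) :
    (∑' k, localTerm q u P k) * (1 - (u ^ 2) ^ P.1.natDegree)⁻¹ =
      (1 - u ^ P.1.natDegree)⁻¹ ^ 3 * (1 + u ^ P.1.natDegree * (u ^ P.1.natDegree - 3) /
        ((nm q P.1 + 1) * (1 + u ^ P.1.natDegree))) := by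
  have hx := (norm_pow_natDegree_le q hu P).trans_lt hu
  have ht : 1 + 1 / nm q P.1 ≠ 0 :=
    norm_pos_iff.mp (zero_lt_one.trans_le (one_le_norm_one_add_inv_nm q P.1))
  have hN : nm q P.1 ≠ 0 :=
    pow_ne_zero _ (Nat.cast_ne_zero.mpr (Fact.out : q.Prime).ne_zero)
  rw [← pow_mul, mul_comm 2, pow_mul]
  have hlocal (k : ℕ) : localTerm q u P k =
      1 / (1 + 1 / nm q P.1) * ((2 * k + 1) * (u ^ P.1.natDegree) ^ k) +
        if k = 0 then 1 - 1 / (1 + 1 / nm q P.1) else 0 := by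
    unfold localTerm
    split_ifs with hk
    · simp [hk]
    · ring
  simp_rw [hlocal]
  rw [(((hasSum_odd_mul_geometric hx).mul_left _).add (hasSum_ite_eq 0 _)).tsum_eq]
  generalize u ^ P.1.natDegree = x at *
  generalize nm q P.1 = N at *
  have hx1 : 1 - x ≠ 0 := sub_ne_zero.mpr fun h => by simp [← h] at hx
  have hx2 : 1 + x ≠ 0 := fun h => by
    rw [eq_neg_of_add_eq_zero_right h] at hx
    simp at hx
  have hN1 : N + 1 ≠ 0 := by
    rwa [one_add_div hN, div_ne_zero_iff, and_iff_left hN] at ht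
  have hx3 : 1 - x ^ 2 ≠ 0 := by
    rw [show 1 - x ^ 2 = (1 - x) * (1 + x) by ring]
    exact mul_ne_zero hx1 hx2
  rw [one_add_div hN]
  field_simp
  ring

end EulerProduct

theorem euler_product_identity_d2 (q : ℕ) [Fact q.Prime] :
    (∀ u : ℂ, ‖u‖ < 1 / q →
      HasSum
        (fun l : {l : Fqx q // l.Monic} =>
          (dk q 2 (l.1 ^ 2) : ℂ) /
            (∏' P : {P : Fqx q // P.Monic ∧ Irreducible P ∧ P ∣ l.1},
              (1 + 1 / nm q P.1)) * u ^ l.1.natDegree)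
        ((1 - q * u ^ 2) / (1 - q * u) ^ 3 * Bfun q u)) ∧
    (∀ u : ℂ, ‖u‖ < 1 →
      Summable fun P : MIrr q =>
        ‖u ^ P.1.natDegree * (u ^ P.1.natDegree - 3) /
          ((nm q P.1 + 1) * (1 + u ^ P.1.natDegree))‖) := by
  refine ⟨fun u hu => ?_, fun u hu => summable_norm_Bfun_factor q hu⟩
  have hq : (1 : ℝ) ≤ q := mod_cast (Fact.out : q.Prime).one_le
  have hu1 : ‖u‖ < 1 := hu.trans_le (by rw [div_le_one (by positivity)]; exact hq)
  have hu2 : ‖u ^ 2‖ < 1 / q := by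
    rw [norm_pow]
    exact (pow_le_of_le_one (norm_nonneg u) hu1.le two_ne_zero).trans_lt hu
  obtain ⟨hs, hprod⟩ := hasSum_hasProd_of_norm_le q hu (g := localTerm q u)
    (fun _ => if_pos rfl) (norm_localTerm_le q u)
  have hB : HasProd _ (Bfun q u) :=
    (multipliable_one_add_of_summable (summable_norm_Bfun_factor q hu1)).hasProd
  have hZ := hasProd_zeta q hu
  have hl := hprod.mul (hasProd_zeta q hu2)
  simp only [tsum_localTerm_mul q hu1] at hl
  have heq := hl.unique ((hZ.pow 3).mul hB)
  have hne : 1 - q * u ^ 2 ≠ 0 := by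
    have hqu : q * ‖u ^ 2‖ < 1 := by rwa [lt_div_iff₀ (by positivity), mul_comm] at hu2
    exact sub_ne_zero.mpr fun h => by
      have := congrArg norm h
      rw [norm_one, norm_mul, Complex.norm_natCast] at this
      linarith
  rw [← monicFinsuppEquiv.hasSum_iff]
  convert hs.hasSum using 1
  · ext n
    exact (localTerm_finsupp_prod q u n).symm
  · rw [← div_eq_mul_inv, div_eq_iff hne] at heq
    rw [heq, inv_pow]
    ring
end
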